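/- arXiv:2605.18049 — 6 statements merged into one kernel-verified Lean document; each statement's English description precedes it below -/
import Mathlib

section
/- Let (Ω,F,P) be a probability space and R : L^∞(Ω) → ℝ a risk measure with R(0) = 0. Fix a sequence of portfolio weights (λ_n) ⊂ (0,∞) and set λ̄_n := (1/n)∑_{i=1}^n λ_i. Then the following are equivalent: (i) R is continuous from above and from below at zero; (ii) for every sequence (X_n) ⊂ L^∞(Ω) and every sequence (m_n) ⊂ ℝ such that S_n := (1/(n λ̄_n)) ∑_{i=1}^n λ_i (X_i − m_i) converges to 0 in probability and the sequence (S_n) is P-a.s. uniformly bounded (there exists M > 0 with |S_n| ≤ M a.s. for all n), one has |R((1/(n λ̄_n)) ∑_{i=1}^n λ_i X_i) − (1/(n λ̄_n)) ∑_{i=1}^n λ_i m_i| → 0 as n → ∞. -/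
open MeasureTheory Filter Topology

/-- `X` is a representative of an element of `L^∞(P)`. -/
def EssBdd {Ω : Type*} [MeasurableSpace Ω] (P : Measure Ω) (X : Ω → ℝ) : Prop :=
  AEMeasurable X P ∧ ∃ M : ℝ, ∀ᵐ ω ∂P, |X ω| ≤ M

section EssBdd

variable {Ω : Type*} [MeasurableSpace Ω] {P : Measure Ω}

theorem EssBdd.add {X Y : Ω → ℝ} (hX : EssBdd P X) (hY : EssBdd P Y) :
    EssBdd P (fun ω => X ω + Y ω) := by
  obtain ⟨hXm, M, hM⟩ := hX
  obtain ⟨hYm, N, hN⟩ := hY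
  refine ⟨hXm.add hYm, M + N, ?_⟩
  filter_upwards [hM, hN] with ω h₁ h₂
  exact (abs_add_le _ _).trans (add_le_add h₁ h₂)

theorem EssBdd.const_mul {X : Ω → ℝ} (hX : EssBdd P X) (c : ℝ) :
    EssBdd P (fun ω => c * X ω) := by
  obtain ⟨hXm, M, hM⟩ := hX
  refine ⟨hXm.const_mul c, |c| * M, ?_⟩
  filter_upwards [hM] with ω h
  rw [abs_mul]
  gcongr

/-- Sequential continuity along dominated a.e. convergent sequences, from monotone continuity
at zero. -/
theorem tendsto_of_tendsto_ae_of_bounded {R : (Ω → ℝ) → ℝ}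
    (hmono : ∀ X Y : Ω → ℝ, EssBdd P X → EssBdd P Y → (∀ᵐ ω ∂P, X ω ≤ Y ω) → R X ≤ R Y)
    {a : ℝ}
    (habove : ∀ X : ℕ → Ω → ℝ, (∀ n, EssBdd P (X n)) →
        (∀ n, ∀ᵐ ω ∂P, X (n + 1) ω ≤ X n ω) →
        (∀ᵐ ω ∂P, Tendsto (fun n => X n ω) atTop (𝓝 0)) →
        Tendsto (fun n => R (X n)) atTop (𝓝 a))
    (hbelow : ∀ X : ℕ → Ω → ℝ, (∀ n, EssBdd P (X n)) →
        (∀ n, ∀ᵐ ω ∂P, X n ω ≤ X (n + 1) ω) →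
        (∀ᵐ ω ∂P, Tendsto (fun n => X n ω) atTop (𝓝 0)) →
        Tendsto (fun n => R (X n)) atTop (𝓝 a))
    {S : ℕ → Ω → ℝ} (hS : ∀ n, AEMeasurable (S n) P) {M : ℝ}
    (hM : ∀ n, ∀ᵐ ω ∂P, |S n ω| ≤ M)
    (hlim : ∀ᵐ ω ∂P, Tendsto (fun n => S n ω) atTop (𝓝 0)) :
    Tendsto (fun n => R (S n)) atTop (𝓝 a) := by
  have hM' : ∀ᵐ ω ∂P, ∀ n, |S n ω| ≤ M := ae_all_iff.2 hM
  set T : ℕ → Ω → ℝ := fun k ω => ⨆ j, |S (k + j) ω| with hT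
  have hbdd : ∀ ω, (∀ n, |S n ω| ≤ M) → ∀ k, BddAbove (Set.range fun j => |S (k + j) ω|) := by
    rintro ω h k
    exact ⟨M, by rintro _ ⟨j, rfl⟩; exact h _⟩
  have hTm : ∀ k, AEMeasurable (T k) P := fun k =>
    AEMeasurable.iSup fun j => (hS (k + j)).abs
  have hTnonneg : ∀ k ω, 0 ≤ T k ω := fun k ω => Real.iSup_nonneg fun _ => abs_nonneg _
  have hTb : ∀ k, EssBdd P (T k) := by
    refine fun k => ⟨hTm k, M, ?_⟩
    filter_upwards [hM'] with ω h
    rw [abs_of_nonneg (hTnonneg k ω)]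
    exact ciSup_le fun j => h _
  have hTanti : ∀ k, ∀ᵐ ω ∂P, T (k + 1) ω ≤ T k ω := by
    intro k
    filter_upwards [hM'] with ω h
    refine ciSup_le fun j => ?_
    have := le_ciSup (hbdd ω h k) (1 + j)
    simpa only [add_assoc] using this
  have hTlim : ∀ᵐ ω ∂P, Tendsto (fun k => T k ω) atTop (𝓝 0) := by
    filter_upwards [hlim] with ω h
    rw [Metric.tendsto_atTop] at h ⊢
    intro ε hε
    obtain ⟨N, hN⟩ := h (ε / 2) (half_pos hε)
    refine ⟨N, fun k hk => ?_⟩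
    rw [Real.dist_eq, sub_zero, abs_of_nonneg (hTnonneg k ω)]
    refine (ciSup_le fun j => ?_).trans_lt (half_lt_self hε)
    simpa [Real.dist_eq] using (hN (k + j) (by omega)).le
  have hle : ∀ k, ∀ᵐ ω ∂P, |S k ω| ≤ T k ω := by
    intro k
    filter_upwards [hM'] with ω h
    simpa using le_ciSup (hbdd ω h k) 0
  have hnegb : ∀ k, EssBdd P (fun ω => -T k ω) := fun k => by
    simpa using (hTb k).const_mul (-1)
  have hup := habove T hTb hTanti hTlim
  have hlow := hbelow (fun k ω => -T k ω) hnegb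
    (fun k => (hTanti k).mono fun ω h => neg_le_neg h)
    (hTlim.mono fun ω h => by simpa using h.neg)
  refine tendsto_of_tendsto_of_tendsto_of_le_of_le hlow hup (fun k => ?_) (fun k => ?_)
  · exact hmono _ _ (hnegb k) ⟨hS k, M, hM k⟩ ((hle k).mono fun ω h => (abs_le.1 h).1)
  · exact hmono _ _ ⟨hS k, M, hM k⟩ (hTb k) ((hle k).mono fun ω h => (abs_le.1 h).2)

end EssBdd

/-- Up to its value at `0`, every sequence is a sequence of weighted averages. -/
theorem inv_sum_mul_sum_mul_diff_eq {lam : ℕ → ℝ} (hlam : ∀ n, 0 < lam n) (y : ℕ → ℝ) {n : ℕ}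
    (hn : n ≠ 0) :
    (∑ i ∈ Finset.range n, lam i)⁻¹ * ∑ i ∈ Finset.range n, lam i *
      ((lam i)⁻¹ * (∑ j ∈ Finset.range (i + 1), lam j) * y (i + 1) +
        -((lam i)⁻¹ * ∑ j ∈ Finset.range i, lam j) * y i) = y n := by
  have h : ∀ i ∈ Finset.range n, lam i *
      ((lam i)⁻¹ * (∑ j ∈ Finset.range (i + 1), lam j) * y (i + 1) +
        -((lam i)⁻¹ * ∑ j ∈ Finset.range i, lam j) * y i) =
      (∑ j ∈ Finset.range (i + 1), lam j) * y (i + 1) - (∑ j ∈ Finset.range i, lam j) * y i := by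
    intro i _
    have := (hlam i).ne'
    field_simp
    ring
  rw [Finset.sum_congr rfl h,
    Finset.sum_range_sub (fun i => (∑ j ∈ Finset.range i, lam j) * y i)]
  have : 0 < ∑ i ∈ Finset.range n, lam i :=
    Finset.sum_pos (fun i _ => hlam i) (Finset.nonempty_range_iff.2 hn)
  simp [this.ne']

/-- For a risk measure `R` on `L^∞(Ω)` with `R 0 = 0`, continuity from
above and below at zero is equivalent to convergence of unexpected losses along weighted
averages satisfying a weak law of large numbers with a.s. uniformly bounded averages. -/
theorem stmt_2
    {Ω : Type*} [MeasurableSpace Ω] (P : Measure Ω) [IsProbabilityMeasure P]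
    (Linf : (Ω → ℝ) → Prop)
    (hLinfdef : ∀ X : Ω → ℝ,
      Linf X ↔ (AEMeasurable X P ∧ ∃ M : ℝ, ∀ᵐ ω ∂P, |X ω| ≤ M))
    (R : (Ω → ℝ) → ℝ)
    (hmono : ∀ X Y : Ω → ℝ, Linf X → Linf Y → (∀ᵐ ω ∂P, X ω ≤ Y ω) → R X ≤ R Y)
    (hcash : ∀ X : Ω → ℝ, Linf X → ∀ m : ℝ, R (fun ω => X ω + m) = R X + m)
    (hR0 : R 0 = 0)
    (lam : ℕ → ℝ) (hlam : ∀ n, 0 < lam n) :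
    ((∀ X : ℕ → Ω → ℝ, (∀ n, Linf (X n)) →
        (∀ n, ∀ᵐ ω ∂P, X (n + 1) ω ≤ X n ω) →
        (∀ᵐ ω ∂P, Tendsto (fun n => X n ω) atTop (𝓝 0)) →
        Tendsto (fun n => R (X n)) atTop (𝓝 (R 0))) ∧
      (∀ X : ℕ → Ω → ℝ, (∀ n, Linf (X n)) →
        (∀ n, ∀ᵐ ω ∂P, X n ω ≤ X (n + 1) ω) →
        (∀ᵐ ω ∂P, Tendsto (fun n => X n ω) atTop (𝓝 0)) →
        Tendsto (fun n => R (X n)) atTop (𝓝 (R 0))))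
    ↔
    (∀ (X : ℕ → Ω → ℝ) (m : ℕ → ℝ), (∀ n, Linf (X n)) →
      (∀ ε > (0:ℝ), Tendsto
        (fun n => P {ω | ε < |(∑ i ∈ Finset.range n, lam i)⁻¹ *
            ∑ i ∈ Finset.range n, lam i * (X i ω - m i)|}) atTop (𝓝 0)) →
      (∃ M > (0:ℝ), ∀ n, ∀ᵐ ω ∂P,
        |(∑ i ∈ Finset.range n, lam i)⁻¹ *
            ∑ i ∈ Finset.range n, lam i * (X i ω - m i)| ≤ M) →
      Tendsto (fun n =>
        |R (fun ω => (∑ i ∈ Finset.range n, lam i)⁻¹ *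
              ∑ i ∈ Finset.range n, lam i * X i ω)
          - (∑ i ∈ Finset.range n, lam i)⁻¹ * ∑ i ∈ Finset.range n, lam i * m i|)
        atTop (𝓝 0)) := by
  obtain rfl : Linf = EssBdd P := funext fun X => propext (hLinfdef X)
  constructor
  · rintro ⟨habove, hbelow⟩ X m hX hprob ⟨M, -, hM⟩
    set S : ℕ → Ω → ℝ := fun n ω => (∑ i ∈ Finset.range n, lam i)⁻¹ *
      ∑ i ∈ Finset.range n, lam i * (X i ω - m i) with hSdef
    have hSm : ∀ n, AEMeasurable (S n) P := fun n =>
      (Finset.aemeasurable_fun_sum _ fun i _ =>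
        ((hX i).1.sub_const (m i)).const_mul (lam i)).const_mul _
    have hmeas : TendstoInMeasure P S atTop 0 := by
      rw [tendstoInMeasure_iff_norm]
      intro ε hε
      refine tendsto_of_tendsto_of_tendsto_of_le_of_le tendsto_const_nhds
        (hprob (ε / 2) (half_pos hε)) (fun _ => zero_le) fun n => measure_mono fun ω hω => ?_
      simp only [Set.mem_ofPred_eq, Pi.zero_apply, sub_zero, Real.norm_eq_abs] at hω ⊢
      exact (half_lt_self hε).trans_le hω
    have hRS : Tendsto (fun n => R (S n)) atTop (𝓝 0) := by
      refine tendsto_of_subseq_tendsto fun ns hns => ?_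
      obtain ⟨ms, -, hms⟩ := (hmeas.comp hns).exists_seq_tendsto_ae
      refine ⟨ms, ?_⟩
      rw [hR0] at habove hbelow
      exact tendsto_of_tendsto_ae_of_bounded hmono habove hbelow (fun k => hSm (ns (ms k)))
        (fun k => hM (ns (ms k))) hms
    have heq : ∀ n, R (fun ω => (∑ i ∈ Finset.range n, lam i)⁻¹ *
          ∑ i ∈ Finset.range n, lam i * X i ω)
        - (∑ i ∈ Finset.range n, lam i)⁻¹ * ∑ i ∈ Finset.range n, lam i * m i = R (S n) := by
      intro n
      rw [sub_eq_iff_eq_add, ← hcash (S n) ⟨hSm n, M, hM n⟩]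
      congr 1
      ext ω
      simp only [hSdef, mul_sub, Finset.sum_sub_distrib]
      ring
    simp only [heq]
    simpa using hRS.abs
  · intro h
    have key : ∀ Y : ℕ → Ω → ℝ, (∀ n, EssBdd P (Y n)) →
        (∀ n, ∀ᵐ ω ∂P, |Y n ω| ≤ |Y 0 ω|) →
        (∀ᵐ ω ∂P, Tendsto (fun n => Y n ω) atTop (𝓝 0)) →
        Tendsto (fun n => R (Y n)) atTop (𝓝 (R 0)) := by
      intro Y hY hYb hYlim
      have hX : ∀ i, EssBdd P (fun ω =>
          (lam i)⁻¹ * (∑ j ∈ Finset.range (i + 1), lam j) * Y (i + 1) ω +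
            -((lam i)⁻¹ * ∑ j ∈ Finset.range i, lam j) * Y i ω) := fun i =>
        ((hY (i + 1)).const_mul _).add ((hY i).const_mul _)
      have havg : ∀ n, n ≠ 0 → ∀ ω, _ = Y n ω := fun n hn ω =>
        inv_sum_mul_sum_mul_diff_eq hlam (fun k => Y k ω) hn
      have hmeas := tendstoInMeasure_of_tendsto_ae (g := 0)
        (fun n => (hY n).1.aestronglyMeasurable) hYlim
      rw [tendstoInMeasure_iff_norm] at hmeas
      obtain ⟨-, M, hM⟩ := hY 0
      have hR := h _ (fun _ => 0) hX ?_ ⟨max M 1, by positivity, ?_⟩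
      · simp only [mul_zero, Finset.sum_const_zero, sub_zero] at hR
        rw [hR0]
        refine (tendsto_zero_iff_abs_tendsto_zero _).2 (hR.congr' ?_)
        filter_upwards [eventually_ne_atTop 0] with n hn
        simp only [havg n hn, Function.comp_apply]
      · intro ε hε
        refine tendsto_of_tendsto_of_tendsto_of_le_of_le' tendsto_const_nhds
          (hmeas ε hε) (.of_forall fun _ => zero_le) ?_
        filter_upwards [eventually_ne_atTop 0] with n hn
        refine measure_mono fun ω hω => ?_
        simp only [sub_zero, havg n hn, Set.mem_ofPred_eq] at hω
        simpa using hω.le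
      · intro n
        rcases eq_or_ne n 0 with rfl | hn
        · simp
        · filter_upwards [hYb n, hM] with ω h₁ h₂
          simp only [sub_zero, havg n hn]
          exact (h₁.trans h₂).trans (le_max_left _ _)
    refine ⟨fun Y hY hanti hlim => key Y hY (fun n => ?_) hlim,
      fun Y hY hmonoY hlim => key Y hY (fun n => ?_) hlim⟩
    · filter_upwards [ae_all_iff.2 hanti, hlim] with ω h₁ h₂
      have hA : Antitone fun n => Y n ω := antitone_nat_of_succ_le h₁
      exact abs_le_abs_of_nonneg (hA.le_of_tendsto h₂ n) (hA (Nat.zero_le n))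
    · filter_upwards [ae_all_iff.2 hmonoY, hlim] with ω h₁ h₂
      have hA : Monotone fun n => Y n ω := monotone_nat_of_le_succ h₁
      exact abs_le_abs_of_nonpos (hA.ge_of_tendsto h₂ n) (hA (Nat.zero_le n))
end

section
/- Let (Ω,F,P) be a probability space and R : L^∞(Ω) → ℝ a risk measure that is continuous from above and from below at zero. Then for every sequence (Y_n) ⊂ L^∞(Ω) that is P-a.s. uniformly bounded (there exists M > 0 with |Y_n| ≤ M a.s. for all n) and converges to 0 in probability, one has R(Y_n) → R(0) as n → ∞. -/
open MeasureTheory Filter Topology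

/-- The tail suprema of the absolute values of a null sequence of reals converge to zero. -/
theorem tendsto_iSup_abs_add_zero {z : ℕ → ℝ} (hz : Tendsto z atTop (𝓝 0)) :
    Tendsto (fun n => ⨆ k, |z (n + k)|) atTop (𝓝 0) := by
  rw [Metric.tendsto_atTop] at hz ⊢
  intro ε hε
  obtain ⟨N, hN⟩ := hz (ε / 2) (half_pos hε)
  refine ⟨N, fun n hn => ?_⟩
  have hle : ⨆ k, |z (n + k)| ≤ ε / 2 := by
    refine ciSup_le fun k => ?_
    have h := hN (n + k) (by omega)
    rw [Real.dist_0_eq_abs] at h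
    exact h.le
  have hnonneg : 0 ≤ ⨆ k, |z (n + k)| := Real.iSup_nonneg fun k => abs_nonneg _
  rw [Real.dist_0_eq_abs, abs_of_nonneg hnonneg]
  linarith

/-- A risk measure on `L^∞(Ω)` that is continuous from above and below
at zero is continuous at zero along every a.s. uniformly bounded sequence converging to
zero in probability. -/
theorem stmt_3
    {Ω : Type*} [MeasurableSpace Ω] (P : Measure Ω) [IsProbabilityMeasure P]
    (Linf : (Ω → ℝ) → Prop)
    (hLinfdef : ∀ X : Ω → ℝ,
      Linf X ↔ (AEMeasurable X P ∧ ∃ M : ℝ, ∀ᵐ ω ∂P, |X ω| ≤ M))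
    (R : (Ω → ℝ) → ℝ)
    (hmono : ∀ X Y : Ω → ℝ, Linf X → Linf Y → (∀ᵐ ω ∂P, X ω ≤ Y ω) → R X ≤ R Y)
    (hcash : ∀ X : Ω → ℝ, Linf X → ∀ m : ℝ, R (fun ω => X ω + m) = R X + m)
    (habove : ∀ X : ℕ → Ω → ℝ, (∀ n, Linf (X n)) →
      (∀ n, ∀ᵐ ω ∂P, X (n + 1) ω ≤ X n ω) →
      (∀ᵐ ω ∂P, Tendsto (fun n => X n ω) atTop (𝓝 0)) →
      Tendsto (fun n => R (X n)) atTop (𝓝 (R 0)))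
    (hbelow : ∀ X : ℕ → Ω → ℝ, (∀ n, Linf (X n)) →
      (∀ n, ∀ᵐ ω ∂P, X n ω ≤ X (n + 1) ω) →
      (∀ᵐ ω ∂P, Tendsto (fun n => X n ω) atTop (𝓝 0)) →
      Tendsto (fun n => R (X n)) atTop (𝓝 (R 0))) :
    ∀ Y : ℕ → Ω → ℝ, (∀ n, Linf (Y n)) →
      (∃ M > (0:ℝ), ∀ n, ∀ᵐ ω ∂P, |Y n ω| ≤ M) →
      (∀ ε > (0:ℝ), Tendsto (fun n => P {ω | ε < |Y n ω|}) atTop (𝓝 0)) →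
      Tendsto (fun n => R (Y n)) atTop (𝓝 (R 0)) := by
  rintro Y hY ⟨M, -, hM⟩ hP
  have hmeas : TendstoInMeasure P Y atTop 0 := by
    rw [tendstoInMeasure_iff_norm]
    intro ε hε
    refine tendsto_of_tendsto_of_tendsto_of_le_of_le tendsto_const_nhds (hP (ε / 2) (half_pos hε))
      (fun _ => zero_le) fun n => measure_mono fun ω hω => ?_
    simp only [Set.mem_ofPred_eq, Pi.zero_apply, sub_zero, Real.norm_eq_abs] at hω ⊢
    linarith
  refine tendsto_of_subseq_tendsto fun ns hns => ?_
  obtain ⟨ms, -, hae⟩ := (hmeas.comp hns).exists_seq_tendsto_ae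
  refine ⟨ms, ?_⟩
  set Z : ℕ → Ω → ℝ := fun n => Y (ns (ms n))
  have hbound : ∀ᵐ ω ∂P, ∀ n, |Z n ω| ≤ M := ae_all_iff.2 fun n => hM _
  have hlim : ∀ᵐ ω ∂P, Tendsto (fun n => Z n ω) atTop (𝓝 0) := hae
  set S : ℕ → Ω → ℝ := fun n ω => ⨆ k, |Z (n + k) ω|
  have hbdd : ∀ᵐ ω ∂P, ∀ n, BddAbove (Set.range fun k => |Z (n + k) ω|) := by
    filter_upwards [hbound] with ω hω n
    exact ⟨M, Set.forall_mem_range.2 fun k => hω _⟩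
  have hSmeas (n : ℕ) : AEMeasurable (S n) P :=
    AEMeasurable.iSup fun k => ((hLinfdef _).1 (hY _)).1.abs
  have hSbound (n : ℕ) : ∀ᵐ ω ∂P, |S n ω| ≤ M := by
    filter_upwards [hbound] with ω hω
    rw [abs_of_nonneg (Real.iSup_nonneg fun k => abs_nonneg _)]
    exact ciSup_le fun k => hω _
  have hS (n : ℕ) : Linf (S n) := (hLinfdef _).2 ⟨hSmeas n, M, hSbound n⟩
  have hnegS (n : ℕ) : Linf (-S n) :=
    (hLinfdef _).2 ⟨(hSmeas n).neg, M, by simpa using hSbound n⟩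
  have hanti (n : ℕ) : ∀ᵐ ω ∂P, S (n + 1) ω ≤ S n ω := by
    filter_upwards [hbdd] with ω hω
    refine ciSup_le fun k => ?_
    rw [add_assoc]
    exact le_ciSup (hω n) (1 + k)
  have hSlim : ∀ᵐ ω ∂P, Tendsto (fun n => S n ω) atTop (𝓝 0) := by
    filter_upwards [hlim] with ω hω using tendsto_iSup_abs_add_zero hω
  have hZS (n : ℕ) : ∀ᵐ ω ∂P, |Z n ω| ≤ S n ω := by
    filter_upwards [hbdd] with ω hω using le_ciSup (hω n) 0
  have hupper := habove S hS hanti hSlim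
  have hlower := hbelow (fun n => -S n) hnegS
    (fun n => (hanti n).mono fun ω hω => neg_le_neg hω)
    (hSlim.mono fun ω hω => by simpa using hω.neg)
  refine tendsto_of_tendsto_of_tendsto_of_le_of_le hlower hupper (fun n => ?_) fun n => ?_
  · exact hmono _ _ (hnegS n) (hY _) ((hZS n).mono fun ω hω => (abs_le.1 hω).1)
  · exact hmono _ _ (hY _) (hS n) ((hZS n).mono fun ω hω => (abs_le.1 hω).2)
end

section
/- Let (Ω,F,P) be a probability space, p ∈ [1,∞), C > 0, and let h : [0,∞) → [0,1] be nondecreasing with h(t) = 1 for t > 1, lim_{u↓0} h(u) = 0, lim_{u↑1} h(u) = 1, and ∫₁^∞ h(x^{−p}) dx < ∞. Fix portfolio weights (λ_n) ⊂ (0,∞) and set λ̄_n := (1/n)∑_{i=1}^n λ_i. Let (X_n) be a sequence of nonnegative random variables with E[X_n] = m for all n, sup_n E[X_n^p] < ∞, and such that (1/(n λ̄_n)) ∑_{i=1}^n λ_i (X_i − m) converges to 0 in probability. Then, with H(X) := C ∫₀^∞ h(P(X > x)) dx, one has | (1/(n λ̄_n)) H( ∑_{i=1}^n λ_i X_i )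 − C m | → 0 as n → ∞. -/
open MeasureTheory Filter Topology

lemma lintegral_Ioi_mul_left {c : ℝ} (hc : 0 < c) (a : ℝ) (f : ℝ → ENNReal) :
    ∫⁻ x in Set.Ioi (c * a), f x = ENNReal.ofReal c * ∫⁻ y in Set.Ioi a, f (c * y) := by
  rw [← lintegral_indicator measurableSet_Ioi, ← lintegral_indicator measurableSet_Ioi]
  conv_lhs => rw [← Real.smul_map_volume_mul_left hc.ne']
  rw [lintegral_smul_measure, abs_of_pos hc, smul_eq_mul]
  congr 1
  have he : MeasurableEmbedding (fun x : ℝ => c * x) :=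
    (Homeomorph.mulLeft₀ c hc.ne').measurableEmbedding
  rw [he.lintegral_map]
  refine lintegral_congr fun y => ?_
  simp [Set.indicator, mul_lt_mul_iff_right₀ hc]

/-- Dominated convergence for distorted tail functions whose mass concentrates at `m`. -/
lemma tendsto_lintegral_distortion_tail {p : ℝ} (hp : 1 ≤ p) {h : ℝ → ℝ}
    (hmono : MonotoneOn h (Set.Ici 0))
    (hrange : ∀ t : ℝ, 0 ≤ t → h t ∈ Set.Icc (0 : ℝ) 1)
    (hzero : Tendsto h (𝓝[>] 0) (𝓝 0)) (hone : Tendsto h (𝓝[<] 1) (𝓝 1))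
    (hint : ∫⁻ x in Set.Ioi (1 : ℝ), ENNReal.ofReal (h (x ^ (-p))) < ⊤)
    {T : ℕ → ℝ → ℝ} (hanti : ∀ n, Antitone (T n)) (hT : ∀ n y, T n y ∈ Set.Icc (0 : ℝ) 1)
    {M : ℝ} (hM : 0 < M) (htail : ∀ n y, 0 < y → T n y ≤ M * y ^ (-p)) {m : ℝ}
    (hlt : ∀ y, y < m → Tendsto (fun n => T n y) atTop (𝓝 1))
    (hgt : ∀ y, m < y → Tendsto (fun n => T n y) atTop (𝓝 0)) :
    Tendsto (fun n => ∫⁻ y in Set.Ioi (0 : ℝ), ENNReal.ofReal (h (T n y))) atTop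
      (𝓝 (ENNReal.ofReal m)) := by
  have hp0 : p ≠ 0 := by positivity
  have h0 : h 0 = 0 := by
    refine le_antisymm (ge_of_tendsto hzero ?_) (hrange 0 le_rfl).1
    filter_upwards [self_mem_nhdsWithin] with t ht
    exact hmono (Set.mem_Ici.2 le_rfl) (Set.mem_Ici.2 (le_of_lt ht)) (le_of_lt ht)
  have h1 : h 1 = 1 := by
    refine le_antisymm (hrange 1 zero_le_one).2 (le_of_tendsto hone ?_)
    filter_upwards [self_mem_nhdsWithin, mem_nhdsWithin_of_mem_nhds (Ioi_mem_nhds zero_lt_one)]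
      with t ht ht0
    exact hmono (Set.mem_Ici.2 (le_of_lt ht0)) (Set.mem_Ici.2 zero_le_one) (le_of_lt ht)
  have hc0 : ContinuousWithinAt h (Set.Ici 0) 0 := by
    rw [← continuousWithinAt_Ioi_iff_Ici, ContinuousWithinAt, h0]; exact hzero
  have hc1 : ContinuousWithinAt h (Set.Iic 1) 1 := by
    rw [← continuousWithinAt_Iio_iff_Iic, ContinuousWithinAt, h1]; exact hone
  set K : ℝ := M ^ p⁻¹ with hK
  have hK0 : 0 < K := by positivity
  have hKp : K ^ p = M := by rw [hK, ← Real.rpow_mul hM.le, inv_mul_cancel₀ hp0, Real.rpow_one]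
  have hlim : ∫⁻ y in Set.Ioi (0 : ℝ), (Set.Iio m).indicator (fun _ => (1 : ENNReal)) y
      = ENNReal.ofReal m := by
    rw [lintegral_indicator measurableSet_Iio, lintegral_one, Measure.restrict_restrict
      measurableSet_Iio, Measure.restrict_apply_univ, Set.inter_comm, Set.Ioi_inter_Iio,
      Real.volume_Ioo, sub_zero]
  rw [← hlim]
  refine tendsto_lintegral_of_dominated_convergence
    (fun y => (Set.Iic K).indicator (fun _ => (1 : ENNReal)) y
      + (Set.Ioi K).indicator (fun y => ENNReal.ofReal (h ((K⁻¹ * y) ^ (-p)))) y) ?_ ?_ ?_ ?_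
  · intro n
    refine ENNReal.measurable_ofReal.comp (Antitone.measurable fun a b hab => ?_)
    exact hmono (hT n b).1 (hT n a).1 (hanti n hab)
  · intro n
    filter_upwards [ae_restrict_mem measurableSet_Ioi] with y hy
    rcases le_or_gt y K with hyK | hyK
    · simp only [Set.indicator, Set.mem_Iic, hyK, if_true]
      refine le_trans ?_ le_self_add
      simpa using ENNReal.ofReal_le_ofReal (hrange _ (hT n y).1).2
    · simp only [Set.indicator, Set.mem_Ioi, hyK, if_true]
      refine le_trans ?_ le_add_self
      have hy0 : 0 < y := hy
      refine ENNReal.ofReal_le_ofReal (hmono (hT n y).1 (Set.mem_Ici.2 (by positivity)) ?_)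
      rw [Real.mul_rpow (by positivity) hy0.le, Real.inv_rpow hK0.le, Real.rpow_neg hK0.le, hKp,
        inv_inv]
      exact htail n y hy0
  · rw [lintegral_add_left (measurable_const.indicator measurableSet_Iic)]
    refine ENNReal.add_ne_top.2 ⟨?_, ?_⟩
    · rw [lintegral_indicator measurableSet_Iic, lintegral_one, Measure.restrict_restrict
        measurableSet_Iic, Measure.restrict_apply_univ, Set.inter_comm, Set.Ioi_inter_Iic]
      simp
    · rw [lintegral_indicator measurableSet_Ioi, Measure.restrict_restrict measurableSet_Ioi,
        Set.Ioi_inter_Ioi, sup_of_le_left hK0.le, ← mul_one K,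
        lintegral_Ioi_mul_left hK0, mul_one]
      refine ENNReal.mul_ne_top ENNReal.ofReal_ne_top ?_
      simpa only [inv_mul_cancel_left₀ hK0.ne'] using hint.ne
  · filter_upwards [ae_restrict_of_ae (Measure.ae_ne volume m)] with y hy
    rcases lt_or_gt_of_ne hy with hym | hym
    · simp only [Set.indicator, Set.mem_Iio, hym, if_true]
      rw [← ENNReal.ofReal_one, ← h1]
      refine ENNReal.tendsto_ofReal (hc1.tendsto.comp ?_)
      exact tendsto_nhdsWithin_iff.2 ⟨hlt y hym, Eventually.of_forall fun n => (hT n y).2⟩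
    · simp only [Set.indicator, Set.mem_Iio, not_lt.2 hym.le, if_false]
      rw [← ENNReal.ofReal_zero, ← h0]
      refine ENNReal.tendsto_ofReal (hc0.tendsto.comp ?_)
      exact tendsto_nhdsWithin_iff.2 ⟨hgt y hym, Eventually.of_forall fun n => (hT n y).1⟩

/-- Markov's inequality for the `p`-th power of a convex combination. -/
lemma measureReal_lt_convexCombination_le {Ω ι : Type*} [MeasurableSpace Ω] {P : Measure Ω}
    {p : ℝ} (hp : 1 ≤ p) (s : Finset ι) {w : ι → ℝ}
    (hw : ∀ i ∈ s, 0 ≤ w i) (hw1 : ∑ i ∈ s, w i = 1) {X : ι → Ω → ℝ}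
    [IsFiniteMeasure P] (hX : ∀ i, ∀ᵐ ω ∂P, 0 ≤ X i ω)
    (hXp : ∀ i, Integrable (fun ω => X i ω ^ p) P) {M : ℝ}
    (hM : ∀ i, ∫ ω, X i ω ^ p ∂P ≤ M) {y : ℝ} (hy : 0 < y) :
    P.real {ω | y < ∑ i ∈ s, w i * X i ω} ≤ M * y ^ (-p) := by
  have hall : ∀ᵐ ω ∂P, ∀ i ∈ s, 0 ≤ X i ω := (s.eventually_all).2 fun i _ => hX i
  have hsub : P.real {ω | y < ∑ i ∈ s, w i * X i ω}
      ≤ P.real {ω | y ^ p ≤ ∑ i ∈ s, w i * X i ω ^ p} := by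
    refine ENNReal.toReal_mono (measure_ne_top _ _) (measure_mono_ae ?_)
    filter_upwards [hall] with ω hω hlt
    exact (Real.rpow_le_rpow hy.le (le_of_lt hlt) (by positivity)).trans
      (Real.rpow_arith_mean_le_arith_mean_rpow s w (fun i => X i ω) hw hw1 hω hp)
  have hmarkov := mul_meas_ge_le_integral_of_nonneg (μ := P)
    (f := fun ω => ∑ i ∈ s, w i * X i ω ^ p) (by
      filter_upwards [hall] with ω hω
      exact Finset.sum_nonneg fun i hi => mul_nonneg (hw i hi) (Real.rpow_nonneg (hω i hi) _))
    (integrable_finsetSum _ fun i _ => (hXp i).const_mul (w i)) (y ^ p)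
  have hbound : ∫ ω, ∑ i ∈ s, w i * X i ω ^ p ∂P ≤ M := by
    rw [integral_finsetSum _ fun i _ => (hXp i).const_mul (w i)]
    calc ∑ i ∈ s, ∫ ω, w i * X i ω ^ p ∂P = ∑ i ∈ s, w i * ∫ ω, X i ω ^ p ∂P := by
          simp only [integral_const_mul]
      _ ≤ ∑ i ∈ s, w i * M :=
          Finset.sum_le_sum fun i hi => mul_le_mul_of_nonneg_left (hM i) (hw i hi)
      _ = M := by rw [← Finset.sum_mul, hw1, one_mul]
  have hyp : 0 < y ^ p := by positivity
  rw [Real.rpow_neg hy.le, ← div_eq_mul_inv, le_div_iff₀ hyp]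
  nlinarith [mul_le_mul_of_nonneg_left hsub hyp.le]

/-- Asymptotic behaviour of distortion premia: under a weighted weak law
of large numbers and a uniform `p`-th moment bound, the normalized distortion premium of
the weighted aggregate loss converges to `C * m`. -/
theorem stmt_5
    {Ω : Type*} [MeasurableSpace Ω] (P : Measure Ω) [IsProbabilityMeasure P]
    (p : ℝ) (hp : 1 ≤ p) (C : ℝ) (hC : 0 < C)
    (h : ℝ → ℝ)
    (hmono : MonotoneOn h (Set.Ici 0))
    (hrange : ∀ t : ℝ, 0 ≤ t → h t ∈ Set.Icc (0:ℝ) 1)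
    (hone : ∀ t : ℝ, 1 < t → h t = 1)
    (hzero : Tendsto h (𝓝[>] 0) (𝓝 0))
    (hone' : Tendsto h (𝓝[<] 1) (𝓝 1))
    (hint : ∫⁻ x in Set.Ioi (1:ℝ), ENNReal.ofReal (h (x ^ (-p))) < ⊤)
    (lam : ℕ → ℝ) (hlam : ∀ n, 0 < lam n)
    (X : ℕ → Ω → ℝ) (m : ℝ)
    (hXmeas : ∀ n, AEMeasurable (X n) P)
    (hXpos : ∀ n, ∀ᵐ ω ∂P, 0 ≤ X n ω)
    (hXint : ∀ n, Integrable (X n) P)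
    (hXmean : ∀ n, ∫ ω, X n ω ∂P = m)
    (hXp : ∀ n, Integrable (fun ω => X n ω ^ p) P)
    (hXpbdd : ∃ M : ℝ, ∀ n, ∫ ω, X n ω ^ p ∂P ≤ M)
    (hwlln : ∀ ε > (0:ℝ), Tendsto
      (fun n => P {ω | ε < |(∑ i ∈ Finset.range n, lam i)⁻¹ *
          ∑ i ∈ Finset.range n, lam i * (X i ω - m)|}) atTop (𝓝 0)) :
    Tendsto (fun n =>
      |(∑ i ∈ Finset.range n, lam i)⁻¹ *
          (C * (∫⁻ x in Set.Ioi (0:ℝ), ENNReal.ofReal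
            (h ((P {ω | x < ∑ i ∈ Finset.range n, lam i * X i ω}).toReal))).toReal)
        - C * m|) atTop (𝓝 0) := by
  obtain ⟨M₀, hM₀⟩ := hXpbdd
  set M := max M₀ 1
  have hM : ∀ n, ∫ ω, X n ω ^ p ∂P ≤ M := fun n => (hM₀ n).trans (le_max_left _ _)
  have hMpos : 0 < M := lt_of_lt_of_le one_pos (le_max_right _ _)
  have hm : 0 ≤ m := hXmean 0 ▸ integral_nonneg_of_ae (hXpos 0)
  set L : ℕ → ℝ := fun n => ∑ i ∈ Finset.range (n + 1), lam i with hL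
  have hLpos : ∀ n, 0 < L n := fun n => Finset.sum_pos (fun i _ => hlam i) (by simp)
  set Y : ℕ → Ω → ℝ := fun n ω => ∑ i ∈ Finset.range (n + 1), (L n)⁻¹ * lam i * X i ω with hY
  have hw1 : ∀ n, ∑ i ∈ Finset.range (n + 1), (L n)⁻¹ * lam i = 1 := fun n => by
    rw [← Finset.mul_sum]; exact inv_mul_cancel₀ (hLpos n).ne'
  have hsum : ∀ n ω, ∑ i ∈ Finset.range (n + 1), lam i * X i ω = L n * Y n ω := fun n ω => by
    simp only [hY, Finset.mul_sum]
    refine Finset.sum_congr rfl fun i _ => ?_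
    field_simp [(hLpos n).ne']
  have hdev : ∀ n ω, (∑ i ∈ Finset.range (n + 1), lam i)⁻¹ *
      ∑ i ∈ Finset.range (n + 1), lam i * (X i ω - m) = Y n ω - m := fun n ω => by
    simp only [mul_sub, Finset.sum_sub_distrib, ← Finset.sum_mul, hsum]
    change (L n)⁻¹ * (L n * Y n ω) - (L n)⁻¹ * (L n * m) = _
    rw [inv_mul_cancel_left₀ (hLpos n).ne', inv_mul_cancel_left₀ (hLpos n).ne']
  have hprob : ∀ ε > 0, Tendsto (fun n => P.real {ω | ε < |Y n ω - m|}) atTop (𝓝 0) := by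
    intro ε hε
    have := (tendsto_add_atTop_iff_nat 1).2 (hwlln ε hε)
    simp only [hdev] at this
    exact (ENNReal.tendsto_toReal ENNReal.zero_ne_top).comp this
  have hlim := tendsto_lintegral_distortion_tail hp hmono hrange hzero hone' hint
    (T := fun n y => P.real {ω | y < Y n ω})
    (fun n a b hab => measureReal_mono fun ω hω => lt_of_le_of_lt hab hω)
    (fun n y => ⟨measureReal_nonneg, measureReal_le_one⟩) hMpos
    (fun n y hy => measureReal_lt_convexCombination_le hp _
      (fun i _ => mul_nonneg (inv_nonneg.2 (hLpos n).le) (hlam i).le) (hw1 n) hXpos hXp hM hy)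
    (by
      intro y hy
      have hlow : Tendsto (fun n => 1 - P.real {ω | (m - y) / 2 < |Y n ω - m|}) atTop (𝓝 1) := by
        simpa using (hprob ((m - y) / 2) (by linarith)).const_sub 1
      refine tendsto_of_tendsto_of_tendsto_of_le_of_le hlow tendsto_const_nhds
        (fun n => ?_) fun n => measureReal_le_one
      have hcover : (Set.univ : Set Ω) ⊆
          {ω | (m - y) / 2 < |Y n ω - m|} ∪ {ω | y < Y n ω} := by
        intro ω _
        by_contra hω
        simp only [Set.mem_union, Set.mem_ofPred_eq, not_or, not_lt] at hω
        linarith [neg_abs_le (Y n ω - m)]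
      have := (measureReal_mono (μ := P) hcover).trans (measureReal_union_le _ _)
      rw [probReal_univ] at this
      change 1 - P.real _ ≤ P.real _
      linarith)
    (by
      intro y hy
      refine squeeze_zero (fun n => measureReal_nonneg) (fun n => measureReal_mono ?_)
        (hprob ((y - m) / 2) (by linarith))
      intro ω hω
      simp only [Set.mem_ofPred_eq] at hω ⊢
      linarith [le_abs_self (Y n ω - m)])
  have hreal := (ENNReal.tendsto_toReal ENNReal.ofReal_ne_top).comp hlim
  rw [ENNReal.toReal_ofReal hm] at hreal
  rw [← tendsto_add_atTop_iff_nat 1]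
  have hfinal := ((hreal.const_mul C).sub_const (C * m)).abs
  rw [sub_self, abs_zero] at hfinal
  refine hfinal.congr fun n => ?_
  have hscale := lintegral_Ioi_mul_left (hLpos n) 0 fun x => ENNReal.ofReal
    (h ((P {ω | x < ∑ i ∈ Finset.range (n + 1), lam i * X i ω}).toReal))
  rw [mul_zero] at hscale
  simp only [hsum, mul_lt_mul_iff_right₀ (hLpos n)] at hscale ⊢
  rw [hscale, ENNReal.toReal_mul, ENNReal.toReal_ofReal (hLpos n).le]
  change _ = |(L n)⁻¹ * _ - _|
  rw [mul_left_comm C, inv_mul_cancel_left₀ (hLpos n).ne']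
  rfl
end

section
/- Let (Ω,F,P) be a probability space, 1 ≤ p < q < ∞, and fix portfolio weights (λ_n) ⊂ (0,∞) with λ̄_n := (1/n)∑_{i=1}^n λ_i. Let (X_n) ⊂ L^p(Ω) satisfy sup_n E[|X_n|^q] < ∞, E[X_n] = E[X₁] > 0 for all n, and suppose (1/(n λ̄_n)) ∑_{i=1}^n λ_i (X_i − E[X₁]) converges to 0 in probability. Let (Z_n) ⊂ L^p(Ω) be such that Z₁,…,Z_n are co-monotonic for each n. Let R : L^p(Ω) → ℝ be a risk measure that is positively homogeneous (R(λX) = λR(X) for all λ > 0) and co-monotonic additive, and assume R(Z_n) = R(Z₁) for all n. Then R( ∑_{i=1}^n λ_i Z_i ) / R( ∑_{i=1}^n λ_i X_i ) → R(Z₁) / E[X₁] as n → ∞. -/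
open MeasureTheory Filter Topology

/-- Random variables `Y 0, …, Y (n-1)` are co-monotonic if, off a `P`-null set `N`,
`(Y i ω - Y i ω') * (Y j ω - Y j ω') ≥ 0` for all `ω, ω' ∉ N` and all `i, j`. -/
def CoMonotonic {Ω : Type*} [MeasurableSpace Ω] (P : MeasureTheory.Measure Ω)
    {n : ℕ} (Y : Fin n → Ω → ℝ) : Prop :=
  ∃ N : Set Ω, P N = 0 ∧
    ∀ ω ∉ N, ∀ ω' ∉ N, ∀ i j : Fin n, 0 ≤ (Y i ω - Y i ω') * (Y j ω - Y j ω')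

/-- A family bounded in `L^q` is uniformly integrable in `L^p` for `p < q`. -/
theorem unifIntegrable_of_eLpNorm_le {Ω ι : Type*} [MeasurableSpace Ω] {P : Measure Ω}
    {p q : ℝ} (hp : 0 < p) (hpq : p < q) {f : ι → Ω → ℝ}
    (hf : ∀ i, AEStronglyMeasurable (f i) P) {C : ENNReal} (hC : C ≠ ⊤)
    (hbd : ∀ i, eLpNorm (f i) (ENNReal.ofReal q) P ≤ C) :
    UnifIntegrable f (ENNReal.ofReal p) P := by
  intro ε hε
  have hr : 0 < 1 / p - 1 / q := sub_pos.2 (one_div_lt_one_div_of_lt hp hpq)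
  set r := 1 / p - 1 / q with hr_def
  have hC0 : 0 ≤ C.toReal := ENNReal.toReal_nonneg
  have hx : 0 < ε / (C.toReal + 1) := by positivity
  refine ⟨(ε / (C.toReal + 1)) ^ r⁻¹, by positivity, fun i s hs hμs => ?_⟩
  rw [eLpNorm_indicator_eq_eLpNorm_restrict hs]
  have h := eLpNorm_le_eLpNorm_mul_rpow_measure_univ (μ := P.restrict s)
    (ENNReal.ofReal_le_ofReal hpq.le) (hf i).restrict
  rw [ENNReal.toReal_ofReal hp.le, ENNReal.toReal_ofReal (hp.trans hpq).le,
    Measure.restrict_apply_univ, ← hr_def] at h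
  calc _ ≤ _ := h
    _ ≤ C * ENNReal.ofReal ((ε / (C.toReal + 1)) ^ r⁻¹) ^ r := by
        gcongr
        exact (eLpNorm_mono_measure _ Measure.restrict_le_self).trans (hbd i)
    _ = ENNReal.ofReal (C.toReal * (ε / (C.toReal + 1))) := by
        rw [ENNReal.ofReal_rpow_of_nonneg (by positivity) hr.le, ← Real.rpow_mul hx.le,
          inv_mul_cancel₀ hr.ne', Real.rpow_one, ENNReal.ofReal_mul hC0, ENNReal.ofReal_toReal hC]
    _ ≤ ENNReal.ofReal ε := by
        apply ENNReal.ofReal_le_ofReal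
        rw [← mul_div_assoc, div_le_iff₀ (by positivity)]
        nlinarith

/-- A sequence tending to zero in `L^p` has a subsequence that is dominated, with geometric rate,
by a single element of `L^p`. -/
theorem exists_subseq_le_geometric_mul {Ω : Type*} [MeasurableSpace Ω] {P : Measure Ω}
    {p : ℝ} (hp : 0 < p) {f : ℕ → Ω → ℝ} (hf : ∀ n, AEMeasurable (f n) P)
    (hlim : Tendsto (fun n => eLpNorm (f n) (ENNReal.ofReal p) P) atTop (𝓝 0)) :
    ∃ φ : ℕ → ℕ, StrictMono φ ∧ ∃ G : Ω → ℝ, AEMeasurable G P ∧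
      Integrable (fun ω => |G ω| ^ p) P ∧
      ∀ k, ∀ᵐ ω ∂P, |f (φ k) ω| ≤ (1 / 2) ^ k * G ω := by
  have hp0 : ENNReal.ofReal p ≠ 0 := by simpa using hp
  have hev : ∀ k : ℕ, ∀ᶠ n in atTop,
      ∫⁻ ω, ‖(2 : ℝ) ^ k * f n ω‖ₑ ^ p ∂P ≤ 2⁻¹ ^ k := by
    intro k
    have h1 : Tendsto (fun n => (‖(2 : ℝ) ^ k‖ₑ * eLpNorm (f n) (ENNReal.ofReal p) P) ^ p)
        atTop (𝓝 0) := by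
      have h2 := (ENNReal.Tendsto.const_mul (a := ‖(2 : ℝ) ^ k‖ₑ) hlim (Or.inr enorm_ne_top))
      have h3 := (ENNReal.continuous_rpow_const (y := p)).tendsto (‖(2 : ℝ) ^ k‖ₑ * 0)
      rw [mul_zero, ENNReal.zero_rpow_of_pos hp] at h3
      rw [mul_zero] at h2
      exact h3.comp h2
    have hpos : (0 : ENNReal) < 2⁻¹ ^ k := ENNReal.pow_pos (by simp) k
    filter_upwards [h1.eventually_le_const hpos] with n hn
    rw [← eLpNorm_const_smul, eLpNorm_eq_lintegral_rpow_enorm_toReal hp0 ENNReal.ofReal_ne_top,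
      ENNReal.toReal_ofReal hp.le, ← ENNReal.rpow_mul, one_div, inv_mul_cancel₀ hp.ne',
      ENNReal.rpow_one] at hn
    exact hn
  obtain ⟨φ, hφ, hle⟩ := extraction_forall_of_eventually hev
  set H : Ω → ENNReal := fun ω => ∑' k : ℕ, ‖(2 : ℝ) ^ k * f (φ k) ω‖ₑ ^ p with hH
  have hmeas : ∀ k : ℕ, AEMeasurable (fun ω => ‖(2 : ℝ) ^ k * f (φ k) ω‖ₑ ^ p) P := fun k =>
    (((hf (φ k)).const_mul _).enorm).pow_const _
  have hHm : AEMeasurable H P := AEMeasurable.tsum hmeas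
  have hHint : ∫⁻ ω, H ω ∂P ≠ ⊤ := by
    rw [hH, lintegral_tsum hmeas]
    refine ne_top_of_le_ne_top ?_ (ENNReal.tsum_le_tsum hle)
    rw [ENNReal.tsum_geometric]
    simp
  refine ⟨φ, hφ, fun ω => (H ω).toReal ^ p⁻¹, hHm.ennreal_toReal.pow_const _, ?_, fun k => ?_⟩
  · refine (integrable_toReal_of_lintegral_ne_top hHm hHint).congr (ae_of_all _ fun ω => ?_)
    have h0 : 0 ≤ (H ω).toReal := ENNReal.toReal_nonneg
    simp only
    rw [abs_of_nonneg (by positivity), ← Real.rpow_mul h0, inv_mul_cancel₀ hp.ne', Real.rpow_one]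
  · filter_upwards [ae_lt_top' hHm hHint] with ω hω
    have h1 : ‖(2 : ℝ) ^ k * f (φ k) ω‖ₑ ^ p ≤ H ω :=
      ENNReal.le_tsum (f := fun k : ℕ => ‖(2 : ℝ) ^ k * f (φ k) ω‖ₑ ^ p) k
    have h2 := ENNReal.toReal_mono hω.ne h1
    rw [← ENNReal.toReal_rpow, toReal_enorm, norm_mul, norm_pow, Real.norm_ofNat,
      Real.norm_eq_abs] at h2
    have h3 : (2 : ℝ) ^ k * |f (φ k) ω| ≤ (H ω).toReal ^ p⁻¹ :=
      (Real.le_rpow_inv_iff_of_pos (by positivity) ENNReal.toReal_nonneg hp).2 h2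
    calc |f (φ k) ω| = (1 / 2) ^ k * (2 ^ k * |f (φ k) ω|) := by
          rw [← mul_assoc, ← mul_pow]; norm_num
      _ ≤ _ := by gcongr

/-- A monotone, positively homogeneous functional on `L^p` that vanishes at zero is continuous
at zero. -/
theorem tendsto_zero_of_monotone_of_posHom {Ω : Type*} [MeasurableSpace Ω] {P : Measure Ω}
    {p : ℝ} (hp : 1 ≤ p) {R : (Ω → ℝ) → ℝ}
    (hmono : ∀ X Y : Ω → ℝ, MemLp X (ENNReal.ofReal p) P → MemLp Y (ENNReal.ofReal p) P →
      (∀ᵐ ω ∂P, X ω ≤ Y ω) → R X ≤ R Y)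
    (hposhom : ∀ X : Ω → ℝ, MemLp X (ENNReal.ofReal p) P → ∀ c : ℝ, 0 < c →
      R (fun ω => c * X ω) = c * R X)
    {f : ℕ → Ω → ℝ} (hf : ∀ n, MemLp (f n) (ENNReal.ofReal p) P)
    (hlim : Tendsto (fun n => eLpNorm (f n) (ENNReal.ofReal p) P) atTop (𝓝 0)) :
    Tendsto (fun n => R (f n)) atTop (𝓝 0) := by
  have hp0 : 0 < p := by linarith
  refine tendsto_of_subseq_tendsto fun ns hns => ?_
  obtain ⟨φ, -, G, hGm, hGi, hG⟩ := exists_subseq_le_geometric_mul hp0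
    (fun n => (hf (ns n)).aestronglyMeasurable.aemeasurable) (hlim.comp hns)
  have hGL : MemLp G (ENNReal.ofReal p) P := by
    rw [← integrable_norm_rpow_iff hGm.aestronglyMeasurable (by simpa using hp0)
      ENNReal.ofReal_ne_top, ENNReal.toReal_ofReal hp0.le]
    exact hGi
  have hgeom : Tendsto (fun k : ℕ => (1 / 2 : ℝ) ^ k) atTop (𝓝 0) :=
    tendsto_pow_atTop_nhds_zero_of_lt_one (by norm_num) (by norm_num)
  refine ⟨φ, tendsto_of_tendsto_of_tendsto_of_le_of_le
    (g := fun k : ℕ => (1 / 2 : ℝ) ^ k * R (-G)) (h := fun k : ℕ => (1 / 2 : ℝ) ^ k * R G)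
    (by simpa using hgeom.mul_const (R (-G))) (by simpa using hgeom.mul_const (R G))
    (fun k => ?_) (fun k => ?_)⟩
  · simp only
    rw [← hposhom _ hGL.neg _ (by positivity)]
    refine hmono _ _ (hGL.neg.const_mul _) (hf _) ?_
    filter_upwards [hG k] with ω hω
    simpa using neg_le_of_abs_le hω
  · simp only
    rw [← hposhom _ hGL _ (by positivity)]
    refine hmono _ _ (hf _) (hGL.const_mul _) ?_
    filter_upwards [hG k] with ω hω
    exact (le_abs_self _).trans hω

/-- Weighted averages of a bounded family in `L^q` obey the same bound. -/
theorem eLpNorm_weighted_average_le {Ω : Type*} [MeasurableSpace Ω] {P : Measure Ω}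
    {q : ENNReal} (hq : 1 ≤ q) {lam : ℕ → ℝ} (hlam : ∀ n, 0 < lam n) {Y : ℕ → Ω → ℝ}
    (hY : ∀ n, AEStronglyMeasurable (Y n) P) {C : ENNReal} (hbd : ∀ n, eLpNorm (Y n) q P ≤ C)
    (n : ℕ) :
    eLpNorm (fun ω => (∑ i ∈ Finset.range n, lam i)⁻¹ *
      ∑ i ∈ Finset.range n, lam i * Y i ω) q P ≤ C := by
  have hfun : (fun ω => (∑ i ∈ Finset.range n, lam i)⁻¹ *
      ∑ i ∈ Finset.range n, lam i * Y i ω) =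
      (∑ i ∈ Finset.range n, lam i)⁻¹ • ∑ i ∈ Finset.range n, lam i • Y i := by
    ext ω; simp
  rcases n.eq_zero_or_pos with rfl | hn
  · simp
  have hpos : 0 < ∑ i ∈ Finset.range n, lam i :=
    Finset.sum_pos (fun i _ => hlam i) (by simpa using hn.ne')
  rw [hfun, eLpNorm_const_smul]
  calc _ ≤ ‖(∑ i ∈ Finset.range n, lam i)⁻¹‖ₑ *
        ∑ i ∈ Finset.range n, eLpNorm (lam i • Y i) q P := by
        gcongr
        exact eLpNorm_sum_le (fun i _ => (hY i).const_smul _) hq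
    _ ≤ ‖(∑ i ∈ Finset.range n, lam i)⁻¹‖ₑ *
        ∑ i ∈ Finset.range n, ENNReal.ofReal (lam i) * C := by
        gcongr with i
        rw [eLpNorm_const_smul, Real.enorm_of_nonneg (hlam i).le]
        gcongr
        exact hbd i
    _ = C := by
        rw [← Finset.sum_mul, ← ENNReal.ofReal_sum_of_nonneg (fun i _ => (hlam i).le),
          Real.enorm_of_nonneg (by positivity), ← mul_assoc,
          ← ENNReal.ofReal_mul (by positivity), inv_mul_cancel₀ hpos.ne', ENNReal.ofReal_one,
          one_mul]

/-- Asymptotic risk ratio between a co-monotonic alternative and a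
diversified benchmark for a co-monotonic additive, positively homogeneous risk measure
on `L^p(Ω)`. -/
theorem stmt_6
    {Ω : Type*} [MeasurableSpace Ω] (P : Measure Ω) [IsProbabilityMeasure P]
    (p q : ℝ) (hp : 1 ≤ p) (hpq : p < q)
    (lam : ℕ → ℝ) (hlam : ∀ n, 0 < lam n)
    (Lp : (Ω → ℝ) → Prop)
    (hLpdef : ∀ X : Ω → ℝ,
      Lp X ↔ (AEMeasurable X P ∧ Integrable (fun ω => |X ω| ^ p) P))
    (R : (Ω → ℝ) → ℝ)
    (hmono : ∀ X Y : Ω → ℝ, Lp X → Lp Y → (∀ᵐ ω ∂P, X ω ≤ Y ω) → R X ≤ R Y)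
    (hcash : ∀ X : Ω → ℝ, Lp X → ∀ c : ℝ, R (fun ω => X ω + c) = R X + c)
    (hposhom : ∀ X : Ω → ℝ, Lp X → ∀ c : ℝ, 0 < c → R (fun ω => c * X ω) = c * R X)
    (hcomadd : ∀ (n : ℕ) (Y : Fin n → Ω → ℝ), (∀ i, Lp (Y i)) → CoMonotonic P Y →
      R (fun ω => ∑ i : Fin n, Y i ω) = ∑ i : Fin n, R (Y i))
    (X : ℕ → Ω → ℝ)
    (hX : ∀ n, Lp (X n))
    (hXint : ∀ n, Integrable (X n) P)
    (hXq : ∀ n, Integrable (fun ω => |X n ω| ^ q) P)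
    (hXqbdd : ∃ M : ℝ, ∀ n, ∫ ω, |X n ω| ^ q ∂P ≤ M)
    (hXmean : ∀ n, ∫ ω, X n ω ∂P = ∫ ω, X 0 ω ∂P)
    (hXmeanpos : 0 < ∫ ω, X 0 ω ∂P)
    (hwlln : ∀ ε > (0:ℝ), Tendsto
      (fun n => P {ω | ε < |(∑ i ∈ Finset.range n, lam i)⁻¹ *
          ∑ i ∈ Finset.range n, lam i * (X i ω - ∫ ω', X 0 ω' ∂P)|}) atTop (𝓝 0))
    (Z : ℕ → Ω → ℝ)
    (hZ : ∀ n, Lp (Z n))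
    (hZcom : ∀ n : ℕ, CoMonotonic P (fun i : Fin n => Z i))
    (hZR : ∀ n, R (Z n) = R (Z 0)) :
    Tendsto (fun n =>
        R (fun ω => ∑ i ∈ Finset.range n, lam i * Z i ω) /
        R (fun ω => ∑ i ∈ Finset.range n, lam i * X i ω)) atTop
      (𝓝 (R (Z 0) / ∫ ω, X 0 ω ∂P)) := by
  have hp0 : 0 < p := by linarith
  have hq1 : 1 ≤ q := by linarith
  have hq0 : 0 < q := by linarith
  have hLp : ∀ Y : Ω → ℝ, Lp Y ↔ MemLp Y (ENNReal.ofReal p) P := by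
    intro Y
    have key : ∀ hY : AEStronglyMeasurable Y P,
        Integrable (fun ω => |Y ω| ^ p) P ↔ MemLp Y (ENNReal.ofReal p) P := by
      intro hY
      rw [← integrable_norm_rpow_iff hY (by simpa using hp0) ENNReal.ofReal_ne_top,
        ENNReal.toReal_ofReal hp0.le]
      rfl
    rw [hLpdef]
    exact ⟨fun h => (key h.1.aestronglyMeasurable).1 h.2,
      fun h => ⟨h.aestronglyMeasurable.aemeasurable, (key h.aestronglyMeasurable).2 h⟩⟩
  simp only [hLp] at hmono hcash hposhom hcomadd hX hZ
  set m := ∫ ω, X 0 ω ∂P with hm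
  obtain ⟨M, hM⟩ := hXqbdd
  have hXLq : ∀ n, MemLp (X n) (ENNReal.ofReal q) P := by
    intro n
    rw [← integrable_norm_rpow_iff (hX n).aestronglyMeasurable (by simpa using hq0)
      ENNReal.ofReal_ne_top, ENNReal.toReal_ofReal hq0.le]
    exact hXq n
  have hone_p : 1 ≤ ENNReal.ofReal p := by simpa using hp
  have hone_q : 1 ≤ ENNReal.ofReal q := by simpa using hq1
  have hbd : ∀ n, eLpNorm (fun ω => X n ω - m) (ENNReal.ofReal q) P ≤
      ENNReal.ofReal (M ^ q⁻¹) + eLpNorm (fun _ : Ω => m) (ENNReal.ofReal q) P := by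
    intro n
    refine (eLpNorm_sub_le (hX n).aestronglyMeasurable aestronglyMeasurable_const hone_q).trans ?_
    gcongr
    rw [(hXLq n).eLpNorm_eq_integral_rpow_norm (by simpa using hq0) ENNReal.ofReal_ne_top,
      ENNReal.toReal_ofReal hq0.le]
    gcongr
    exact hM n
  have hC : ENNReal.ofReal (M ^ q⁻¹) + eLpNorm (fun _ : Ω => m) (ENNReal.ofReal q) P ≠ ⊤ :=
    ENNReal.add_ne_top.2 ⟨ENNReal.ofReal_ne_top, (memLp_const m).eLpNorm_ne_top⟩
  have hcen : ∀ n, MemLp (fun ω => X n ω - m) (ENNReal.ofReal p) P := fun n =>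
    (hX n).sub (memLp_const m)
  set S : ℕ → Ω → ℝ := fun n ω => (∑ i ∈ Finset.range n, lam i)⁻¹ *
    ∑ i ∈ Finset.range n, lam i * (X i ω - m) with hS
  have hSL : ∀ n, MemLp (S n) (ENNReal.ofReal p) P := fun n =>
    (memLp_finsetSum _ fun i _ => (hcen i).const_mul (lam i)).const_mul _
  have hSq := eLpNorm_weighted_average_le hone_q hlam
    (fun n => (hcen n).aestronglyMeasurable) hbd
  have hUI : UnifIntegrable S (ENNReal.ofReal p) P :=
    unifIntegrable_of_eLpNorm_le hp0 hpq (fun n => (hSL n).aestronglyMeasurable) hC hSq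
  have hmeas : TendstoInMeasure P S atTop (fun _ => (0 : ℝ)) := by
    rw [tendstoInMeasure_iff_norm]
    intro ε hε
    refine tendsto_of_tendsto_of_tendsto_of_le_of_le tendsto_const_nhds
      (hwlln (ε / 2) (by positivity)) (fun n => zero_le) (fun n => measure_mono fun ω hω => ?_)
    simp only [Set.mem_ofPred_eq, sub_zero, Real.norm_eq_abs] at hω ⊢
    exact (half_lt_self hε).trans_le hω
  have hSlim : Tendsto (fun n => eLpNorm (S n) (ENNReal.ofReal p) P) atTop (𝓝 0) := by
    have h := tendsto_Lp_finite_of_tendstoInMeasure hone_p ENNReal.ofReal_ne_top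
      (fun n => (hSL n).aestronglyMeasurable) (memLp_const (0 : ℝ)) hUI hmeas
    refine h.congr fun n => ?_
    congr 1
    ext ω
    simp
  have hRS := tendsto_zero_of_monotone_of_posHom hp hmono hposhom hSL hSlim
  have hlim : Tendsto (fun n => R (Z 0) / (R (S n) + m)) atTop (𝓝 (R (Z 0) / m)) := by
    refine tendsto_const_nhds.div ?_ hXmeanpos.ne'
    simpa using hRS.add_const m
  refine hlim.congr' ?_
  filter_upwards [eventually_gt_atTop 0] with n hn
  have hpos : 0 < ∑ i ∈ Finset.range n, lam i :=
    Finset.sum_pos (fun i _ => hlam i) (by simpa using hn.ne')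
  have hRX : R (fun ω => ∑ i ∈ Finset.range n, lam i * X i ω) =
      (∑ i ∈ Finset.range n, lam i) * (R (S n) + m) := by
    rw [← hcash _ (hSL n), ← hposhom (fun ω => S n ω + m) ((hSL n).add (memLp_const m)) _ hpos]
    congr 1
    ext ω
    simp only [hS, mul_add, mul_sub, Finset.sum_sub_distrib, ← Finset.sum_mul]
    field_simp
    ring
  have hRZ : R (fun ω => ∑ i ∈ Finset.range n, lam i * Z i ω) =
      (∑ i ∈ Finset.range n, lam i) * R (Z 0) := by
    have hcom : CoMonotonic P (fun (i : Fin n) ω => lam i * Z i ω) := by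
      obtain ⟨N, hN, h⟩ := hZcom n
      refine ⟨N, hN, fun ω hω ω' hω' i j => ?_⟩
      have h1 := mul_nonneg (mul_pos (hlam i) (hlam j)).le (h ω hω ω' hω' i j)
      simp only at h1 ⊢
      linarith
    have h := hcomadd n _ (fun i => (hZ i).const_mul (lam i)) hcom
    simp only [hposhom _ (hZ _) _ (hlam _), hZR] at h
    rw [Finset.sum_mul, ← Fin.sum_univ_eq_sum_range (fun i => lam i * R (Z 0)), ← h]
    congr 1
    ext ω
    rw [Fin.sum_univ_eq_sum_range (fun i => lam i * Z i ω)]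
  rw [hRX, hRZ, mul_div_mul_left _ _ hpos.ne']
end

section
/- Let (Ω,F,P) be a probability space, p ∈ [1,∞), C > 0, and let h : [0,∞) → [0,1] be nondecreasing with h(t) = 1 for t > 1, lim_{u↓0} h(u) = 0, lim_{u↑1} h(u) = 1, and ∫₁^∞ h(x^{−p}) dx < ∞; set H(X) := C ∫₀^∞ h(P(X > x)) dx for nonnegative X ∈ L^p(Ω). Fix portfolio weights (λ_n) ⊂ (0,∞) with λ̄_n := (1/n)∑_{i=1}^n λ_i. Let (X_n) be nonnegative random variables in L^p(Ω) with sup_n E[X_n^p] < ∞, E[X_n] = E[X₁] > 0 for all n, and such that (1/(n λ̄_n)) ∑_{i=1}^n λ_i (X_i − E[X₁]) converges to 0 in probability. Let (Z_n) be nonnegative random variables in L^p(Ω) such that Z₁,…,Z_n are co-monotonic for each n and H(Z_n) = H(Z₁) for all n. Then H( ∑_{i=1}^n λ_i Z_i ) / H( ∑_{i=1}^n λ_i X_i ) → (1/E[X₁]) ∫₀^∞ h(P(Z₁ > x)) dx as n → ∞. -/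
open MeasureTheory Filter Topology

/-- The survival function of `Y` under `P`, distorted by `h`. -/
def distortedTail {Ω : Type*} [MeasurableSpace Ω] (P : Measure Ω) (h : ℝ → ℝ) (Y : Ω → ℝ)
    (x : ℝ) : ℝ :=
  h ((P {ω | x < Y ω}).toReal)

/-- The distortion premium with loading constant `1`, with values in `[0, ∞]`. -/
noncomputable def distortionPremium {Ω : Type*} [MeasurableSpace Ω] (P : Measure Ω) (h : ℝ → ℝ)
    (Y : Ω → ℝ) : ENNReal :=
  ∫⁻ x in Set.Ioi (0:ℝ), ENNReal.ofReal (distortedTail P h Y x)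

section Lebesgue

theorem lintegral_Ioi_comp_inv_mul (f : ℝ → ENNReal) {c : ℝ} (hc : 0 < c) :
    ∫⁻ x in Set.Ioi (0:ℝ), f (c⁻¹ * x) = ENNReal.ofReal c * ∫⁻ x in Set.Ioi (0:ℝ), f x := by
  have hc' : c⁻¹ ≠ 0 := inv_ne_zero hc.ne'
  have he : MeasurableEmbedding (fun x : ℝ => c⁻¹ * x) :=
    (Homeomorph.mulLeft₀ c⁻¹ hc').measurableEmbedding
  have hpre : (fun x : ℝ => c⁻¹ * x) ⁻¹' Set.Ioi 0 = Set.Ioi 0 := by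
    ext x
    simp [hc]
  have key := he.lintegral_map (μ := volume.restrict (Set.Ioi 0)) f
  rw [← key, ← hpre, ← he.restrict_map, Real.map_volume_mul_left hc', hpre]
  simp [abs_of_pos hc]

/-- The Lebesgue measure of a lower subset of `(0, ∞)` bounds its elements from above. -/
theorem ofReal_le_volume_of_mem {A : Set ℝ} (hA : IsLowerSet A) {x : ℝ} (hx : x ∈ A) :
    ENNReal.ofReal x ≤ volume (A ∩ Set.Ioi 0) := by
  calc ENNReal.ofReal x = volume (Set.Ioc 0 x) := by simp
    _ ≤ volume (A ∩ Set.Ioi 0) := measure_mono (fun y hy => ⟨hA hy.2 hx, hy.1⟩)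

theorem volume_le_ofReal_of_notMem {A : Set ℝ} (hA : IsLowerSet A) {x : ℝ} (hx : x ∉ A) :
    volume (A ∩ Set.Ioi 0) ≤ ENNReal.ofReal x := by
  calc volume (A ∩ Set.Ioi 0) ≤ volume (Set.Ioc 0 x) :=
        measure_mono fun y hy => ⟨hy.2, le_of_not_ge fun hxy => hx (hA hxy hy.1)⟩
    _ = _ := by simp

/-- If lower sets `A, B, S` satisfy `A + B ⊆ S` and `Aᶜ + Bᶜ ⊆ Sᶜ` on `(0, ∞)`, their lengths
add up. -/
theorem volume_inter_Ioi_add {A B S : Set ℝ} (hA : IsLowerSet A) (hB : IsLowerSet B)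
    (hS : IsLowerSet S) (hAS : A ∩ Set.Ioi 0 ⊆ S) (hBS : B ∩ Set.Ioi 0 ⊆ S)
    (hadd : ∀ x ∈ A, ∀ y ∈ B, x + y ∈ S) (hcompl : ∀ x ∉ A, ∀ y ∉ B, x + y ∉ S) :
    volume (S ∩ Set.Ioi 0) = volume (A ∩ Set.Ioi 0) + volume (B ∩ Set.Ioi 0) := by
  have mem_of_lt : ∀ {T : Set ℝ}, IsLowerSet T → ∀ {x : ℝ},
      ENNReal.ofReal x < volume (T ∩ Set.Ioi 0) → x ∈ T := fun hT x hx => by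
    by_contra hn
    exact absurd (volume_le_ofReal_of_notMem hT hn) (not_le.2 hx)
  apply le_antisymm
  · by_contra! hlt
    have hfa : volume (A ∩ Set.Ioi 0) ≠ ⊤ := fun e => by simp [e] at hlt
    have hfb : volume (B ∩ Set.Ioi 0) ≠ ⊤ := fun e => by simp [e] at hlt
    obtain ⟨e, he, hlt'⟩ : ∃ e : NNReal, 0 < e ∧
        volume (A ∩ Set.Ioi 0) + volume (B ∩ Set.Ioi 0) + e < volume (S ∩ Set.Ioi 0) := by
      obtain ⟨e, he⟩ := ENNReal.lt_iff_exists_add_pos_lt.1 hlt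
      exact ⟨e, he⟩
    set a := (volume (A ∩ Set.Ioi 0)).toReal with ha
    set b := (volume (B ∩ Set.Ioi 0)).toReal with hb
    have ha0 : 0 ≤ a := ENNReal.toReal_nonneg
    have hb0 : 0 ≤ b := ENNReal.toReal_nonneg
    have he' : (0:ℝ) < e := he
    have hxa : a + e / 2 ∉ A := fun hm => by
      have := ofReal_le_volume_of_mem hA hm
      rw [ENNReal.ofReal_le_iff_le_toReal hfa] at this
      linarith
    have hxb : b + e / 2 ∉ B := fun hm => by
      have := ofReal_le_volume_of_mem hB hm
      rw [ENNReal.ofReal_le_iff_le_toReal hfb] at this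
      linarith
    refine hcompl _ hxa _ hxb (mem_of_lt hS (lt_of_le_of_lt (le_of_eq ?_) hlt'))
    rw [show a + e / 2 + (b + e / 2) = a + b + e by ring, ENNReal.ofReal_add (by positivity) he'.le,
      ENNReal.ofReal_add ha0 hb0, ha, hb, ENNReal.ofReal_toReal hfa, ENNReal.ofReal_toReal hfb,
      ENNReal.ofReal_coe_nnreal]
  · have vol_le : ∀ {T : Set ℝ}, IsLowerSet T → ∀ {c : ENNReal},
        (∀ x ∈ T, 0 ≤ x → ENNReal.ofReal x ≤ c) → volume (T ∩ Set.Ioi 0) ≤ c := by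
      intro T hT c hTc
      by_contra! hlt
      obtain ⟨r, hcr, hr⟩ := ENNReal.lt_iff_exists_nnreal_btwn.1 hlt
      rw [← ENNReal.ofReal_coe_nnreal] at hcr hr
      exact absurd (hTc r (mem_of_lt hT hr) r.2) (not_le.2 hcr)
    have hAvol : volume (A ∩ Set.Ioi 0) ≤ volume (S ∩ Set.Ioi 0) :=
      measure_mono fun x hx => ⟨hAS hx, hx.2⟩
    have hBvol : volume (B ∩ Set.Ioi 0) ≤ volume (S ∩ Set.Ioi 0) :=
      measure_mono fun x hx => ⟨hBS hx, hx.2⟩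
    rcases eq_or_ne (volume (B ∩ Set.Ioi 0)) ⊤ with hb | hb
    · rw [hb, top_le_iff] at hBvol
      simp [hBvol]
    refine add_le_of_le_tsub_right_of_le hBvol (vol_le hA fun x hx hx0 => ?_)
    refine ENNReal.le_sub_of_add_le_right hb ?_
    refine add_le_of_le_tsub_left_of_le ((ofReal_le_volume_of_mem hA hx).trans hAvol)
      (vol_le hB fun y hy hy0 => ENNReal.le_sub_of_add_le_left ENNReal.ofReal_ne_top ?_)
    rw [← ENNReal.ofReal_add hx0 hy0]
    exact ofReal_le_volume_of_mem hS (hadd x hx y hy)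

end Lebesgue

section Distortion

variable {Ω : Type*} [MeasurableSpace Ω] {P : Measure Ω} {h : ℝ → ℝ} {X Y : Ω → ℝ}

theorem distortionPremium_const_mul {c : ℝ} (hc : 0 < c) (Y : Ω → ℝ) :
    distortionPremium P h (fun ω => c * Y ω) = ENNReal.ofReal c * distortionPremium P h Y := by
  rw [distortionPremium, distortionPremium, ← lintegral_Ioi_comp_inv_mul _ hc]
  refine lintegral_congr fun x => ?_
  simp only [distortedTail, inv_mul_lt_iff₀ hc]

theorem distortionPremium_zero (h0 : h 0 = 0) :
    distortionPremium P h (fun _ : Ω => (0:ℝ)) = 0 := by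
  rw [distortionPremium, setLIntegral_congr_fun (g := fun _ => 0) measurableSet_Ioi]
  · simp
  · intro x hx
    simp [distortedTail, h0, not_lt.2 (le_of_lt (Set.mem_Ioi.1 hx))]

variable [IsProbabilityMeasure P]

theorem distortedTail_le_of_ae (hmono : MonotoneOn h (Set.Ici 0)) {x y : ℝ}
    (hxy : ∀ᵐ ω ∂P, x < X ω → y < Y ω) : distortedTail P h X x ≤ distortedTail P h Y y :=
  hmono ENNReal.toReal_nonneg ENNReal.toReal_nonneg
    (ENNReal.toReal_mono (measure_ne_top _ _) (measure_mono_ae hxy))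

theorem antitone_distortedTail (hmono : MonotoneOn h (Set.Ici 0)) (Y : Ω → ℝ) :
    Antitone (distortedTail P h Y) := fun _ _ hxy =>
  distortedTail_le_of_ae hmono (Eventually.of_forall fun _ hy => lt_of_le_of_lt hxy hy)

theorem distortionPremium_eq_lintegral_volume (hmono : MonotoneOn h (Set.Ici 0))
    (hnonneg : ∀ t, 0 ≤ t → 0 ≤ h t) (Y : Ω → ℝ) :
    distortionPremium P h Y =
      ∫⁻ t in Set.Ioi (0:ℝ), volume ({x | t < distortedTail P h Y x} ∩ Set.Ioi 0) := by
  have hm := (antitone_distortedTail (P := P) hmono Y).measurable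
  rw [distortionPremium, lintegral_eq_lintegral_meas_lt (f := distortedTail P h Y) _
    (Eventually.of_forall fun x => hnonneg _ ENNReal.toReal_nonneg) hm.aemeasurable]
  refine lintegral_congr fun t => ?_
  rw [Measure.restrict_apply (measurableSet_lt measurable_const hm)]

/-- Additivity of the distortion premium on a co-monotonic pair. -/
theorem distortionPremium_add_of_comonotonic (hmono : MonotoneOn h (Set.Ici 0))
    (hnonneg : ∀ t, 0 ≤ t → 0 ≤ h t) (hX : ∀ᵐ ω ∂P, 0 ≤ X ω) (hY : ∀ᵐ ω ∂P, 0 ≤ Y ω)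
    {N : Set Ω} (hN : P N = 0)
    (hcom : ∀ ω ∉ N, ∀ ω' ∉ N, 0 ≤ (X ω - X ω') * (Y ω - Y ω')) :
    distortionPremium P h (fun ω => X ω + Y ω) =
      distortionPremium P h X + distortionPremium P h Y := by
  have hlow : ∀ (W : Ω → ℝ) (t : ℝ), IsLowerSet {x | t < distortedTail P h W x} :=
    fun W t x y hyx hx => lt_of_lt_of_le hx (antitone_distortedTail hmono W hyx)
  have hN' : ∀ᵐ ω ∂P, ω ∉ N := measure_eq_zero_iff_ae_notMem.1 hN
  have hchain : ∀ x y : ℝ, (∀ᵐ ω ∂P, x < X ω → y < Y ω) ∨ (∀ᵐ ω ∂P, y < Y ω → x < X ω) := by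
    intro x y
    by_cases hc : ∀ ω ∉ N, x < X ω → y < Y ω
    · exact Or.inl (hN'.mono hc)
    · right
      push Not at hc
      obtain ⟨ω, hω, hx, hy⟩ := hc
      filter_upwards [hN'] with ω' hω' hy'
      by_contra! hx'
      have := hcom ω hω ω' hω'
      nlinarith [mul_pos (show 0 < X ω - X ω' by linarith) (show 0 < Y ω' - Y ω by linarith)]
  simp only [distortionPremium_eq_lintegral_volume hmono hnonneg]
  rw [← lintegral_add_left]
  · refine lintegral_congr fun t => volume_inter_Ioi_add (hlow _ t) (hlow _ t) (hlow _ t) ?_ ?_ ?_ ?_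
    · rintro x ⟨hx, -⟩
      refine lt_of_lt_of_le hx (distortedTail_le_of_ae hmono ?_)
      filter_upwards [hY] with ω hω hx using by linarith
    · rintro x ⟨hx, -⟩
      refine lt_of_lt_of_le hx (distortedTail_le_of_ae hmono ?_)
      filter_upwards [hX] with ω hω hx using by linarith
    · intro x hx y hy
      rcases hchain x y with hc | hc
      · refine lt_of_lt_of_le hx (distortedTail_le_of_ae hmono ?_)
        filter_upwards [hc] with ω hω hx using add_lt_add hx (hω hx)
      · refine lt_of_lt_of_le hy (distortedTail_le_of_ae hmono ?_)
        filter_upwards [hc] with ω hω hx using add_lt_add (hω hx) hx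
    · intro x hx y hy hxy
      rcases hchain x y with hc | hc
      · refine hy (lt_of_lt_of_le hxy (distortedTail_le_of_ae hmono ?_))
        filter_upwards [hc] with ω hω hs
        by_contra! hle
        exact absurd (lt_of_not_ge fun hge => absurd hs (not_lt.2 (add_le_add hge hle)))
          fun hlt => absurd (hω hlt) (not_lt.2 hle)
      · refine hx (lt_of_lt_of_le hxy (distortedTail_le_of_ae hmono ?_))
        filter_upwards [hc] with ω hω hs
        by_contra! hle
        exact absurd (lt_of_not_ge fun hge => absurd hs (not_lt.2 (add_le_add hle hge)))
          fun hlt => absurd (hω hlt) (not_lt.2 hle)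
  · refine Antitone.measurable fun s t hst => measure_mono fun x hx => ⟨?_, hx.2⟩
    exact lt_of_le_of_lt hst hx.1

theorem distortionPremium_sum_of_coMonotonic (hmono : MonotoneOn h (Set.Ici 0))
    (hnonneg : ∀ t, 0 ≤ t → 0 ≤ h t) (h0 : h 0 = 0) {lam : ℕ → ℝ} (hlam : ∀ n, 0 < lam n)
    {Z : ℕ → Ω → ℝ} (hZpos : ∀ n, ∀ᵐ ω ∂P, 0 ≤ Z n ω)
    (hZcom : ∀ n : ℕ, CoMonotonic P (fun i : Fin n => Z i)) (n : ℕ) :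
    distortionPremium P h (fun ω => ∑ i ∈ Finset.range n, lam i * Z i ω) =
      ∑ i ∈ Finset.range n, ENNReal.ofReal (lam i) * distortionPremium P h (Z i) := by
  induction n with
  | zero => simpa using distortionPremium_zero h0
  | succ n ih =>
    obtain ⟨N, hN, hcom⟩ := hZcom (n + 1)
    simp only [Finset.sum_range_succ]
    rw [distortionPremium_add_of_comonotonic hmono hnonneg ?_ ?_ hN, ih,
      distortionPremium_const_mul (hlam n)]
    · intro ω hω ω' hω'
      rw [← Finset.sum_sub_distrib, Finset.sum_mul]
      refine Finset.sum_nonneg fun i hi => ?_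
      have := hcom ω hω ω' hω' ⟨i, (Finset.mem_range.1 hi).trans n.lt_succ_self⟩ (Fin.last n)
      simp only [Fin.val_last] at this
      have := mul_nonneg (mul_pos (hlam i) (hlam n)).le this
      linarith
    · filter_upwards [ae_all_iff.2 hZpos] with ω hω
      exact Finset.sum_nonneg fun i _ => mul_nonneg (hlam i).le (hω i)
    · filter_upwards [hZpos n] with ω hω using mul_nonneg (hlam n).le hω

/-- Markov's inequality for the distorted tail. -/
theorem distortedTail_le_rpow (hmono : MonotoneOn h (Set.Ici 0)) {p : ℝ} (hp : 0 < p)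
    (hY : ∀ᵐ ω ∂P, 0 ≤ Y ω) (hYp : Integrable (fun ω => Y ω ^ p) P) {c : ℝ} (hc : 0 < c)
    (hYc : ∫ ω, Y ω ^ p ∂P ≤ c ^ p) {x : ℝ} (hx : 0 < x) :
    distortedTail P h Y x ≤ h ((c⁻¹ * x) ^ (-p)) := by
  refine hmono ENNReal.toReal_nonneg (Real.rpow_nonneg (by positivity) _) ?_
  have hmarkov := mul_meas_ge_le_integral_of_nonneg
    (hY.mono fun ω hω => Real.rpow_nonneg hω p) hYp (x ^ p)
  have hsub : (P {ω | x < Y ω}).toReal ≤ P.real {ω | x ^ p ≤ Y ω ^ p} :=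
    measureReal_mono fun ω hω => Real.rpow_le_rpow hx.le (le_of_lt hω) hp.le
  have hxp : 0 < x ^ p := Real.rpow_pos_of_pos hx p
  rw [Real.rpow_neg (by positivity), Real.mul_rpow (by positivity) hx.le,
    Real.inv_rpow hc.le, mul_inv, inv_inv, ← div_eq_mul_inv, le_div_iff₀ hxp]
  nlinarith

theorem lintegral_distortion_rpow_lt_top (hle : ∀ t, 0 ≤ t → h t ≤ 1) {p : ℝ}
    (hint : ∫⁻ x in Set.Ioi (1:ℝ), ENNReal.ofReal (h (x ^ (-p))) < ⊤) {c : ℝ} (hc : 0 < c) :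
    ∫⁻ x in Set.Ioi (0:ℝ), ENNReal.ofReal (h ((c⁻¹ * x) ^ (-p))) < ⊤ := by
  rw [lintegral_Ioi_comp_inv_mul (fun x => ENNReal.ofReal (h (x ^ (-p)))) hc]
  refine ENNReal.mul_lt_top ENNReal.ofReal_lt_top ?_
  rw [← Set.Ioc_union_Ioi_eq_Ioi (zero_le_one' ℝ)]
  refine lt_of_le_of_lt (lintegral_union_le _ _ _) (ENNReal.add_lt_top.2 ⟨?_, hint⟩)
  calc ∫⁻ x in Set.Ioc (0:ℝ) 1, ENNReal.ofReal (h (x ^ (-p)))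
      ≤ ∫⁻ _ in Set.Ioc (0:ℝ) 1, 1 := by
        refine setLIntegral_mono measurable_const fun x hx => ?_
        exact ENNReal.ofReal_le_one.2 (hle _ (Real.rpow_nonneg hx.1.le _))
    _ < ⊤ := by simp

theorem distortionPremium_lt_top (hmono : MonotoneOn h (Set.Ici 0))
    (hle : ∀ t, 0 ≤ t → h t ≤ 1) {p : ℝ} (hp : 0 < p)
    (hint : ∫⁻ x in Set.Ioi (1:ℝ), ENNReal.ofReal (h (x ^ (-p))) < ⊤)
    (hY : ∀ᵐ ω ∂P, 0 ≤ Y ω) (hYp : Integrable (fun ω => Y ω ^ p) P) :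
    distortionPremium P h Y < ⊤ := by
  have hI : 0 ≤ ∫ ω, Y ω ^ p ∂P :=
    integral_nonneg_of_ae (hY.mono fun ω hω => Real.rpow_nonneg hω p)
  have hc : 0 < (∫ ω, Y ω ^ p ∂P + 1) ^ p⁻¹ := by positivity
  refine lt_of_le_of_lt (setLIntegral_mono' measurableSet_Ioi fun x hx => ?_)
    (lintegral_distortion_rpow_lt_top hle hint hc)
  refine ENNReal.ofReal_le_ofReal (distortedTail_le_rpow hmono hp hY hYp hc ?_ hx)
  rw [Real.rpow_inv_rpow (by positivity) hp.ne']
  linarith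

/-- A distortion premium is continuous along sequences that are bounded in `L^p` and converge in
probability to a constant. -/
theorem tendsto_distortionPremium_of_tendsto_const (hmono : MonotoneOn h (Set.Ici 0))
    (hle : ∀ t, 0 ≤ t → h t ≤ 1) (h0 : Tendsto h (𝓝[≥] 0) (𝓝 0)) (h1 : Tendsto h (𝓝[≤] 1) (𝓝 1))
    {p : ℝ} (hp : 0 < p)
    (hint : ∫⁻ x in Set.Ioi (1:ℝ), ENNReal.ofReal (h (x ^ (-p))) < ⊤)
    {T : ℕ → Ω → ℝ} (hT : ∀ n, AEMeasurable (T n) P) (hTpos : ∀ n, ∀ᵐ ω ∂P, 0 ≤ T n ω)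
    (hTp : ∀ n, Integrable (fun ω => T n ω ^ p) P) {c : ℝ} (hc : 0 < c)
    (hTc : ∀ n, ∫ ω, T n ω ^ p ∂P ≤ c ^ p) {m : ℝ}
    (hprob : ∀ ε > (0:ℝ), Tendsto (fun n => P {ω | ε < |T n ω - m|}) atTop (𝓝 0)) :
    Tendsto (fun n => distortionPremium P h (T n)) atTop (𝓝 (ENNReal.ofReal m)) := by
  have hlim : ENNReal.ofReal m =
      ∫⁻ x in Set.Ioi (0:ℝ), (Set.Iio m).indicator (fun _ => (1 : ENNReal)) x := by
    rw [lintegral_indicator measurableSet_Iio, setLIntegral_one,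
      Measure.restrict_apply measurableSet_Iio, Set.inter_comm, Set.Ioi_inter_Iio, Real.volume_Ioo,
      sub_zero]
  rw [hlim]
  refine tendsto_lintegral_of_dominated_convergence
    (fun x => ENNReal.ofReal (h ((c⁻¹ * x) ^ (-p))))
    (fun n => (antitone_distortedTail hmono (T n)).measurable.ennreal_ofReal)
    (fun n => (ae_restrict_iff' measurableSet_Ioi).2 (Eventually.of_forall fun x hx =>
      ENNReal.ofReal_le_ofReal (distortedTail_le_rpow hmono hp (hTpos n) (hTp n) hc (hTc n) hx)))
    (lintegral_distortion_rpow_lt_top hle hint hc).ne ?_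
  have hne : ∀ᵐ x ∂(volume.restrict (Set.Ioi (0:ℝ))), x ≠ m :=
    ae_restrict_of_ae (Measure.ae_ne volume m)
  filter_upwards [hne] with x hx
  have hprob' : ∀ ε > (0:ℝ), Tendsto (fun n => (P {ω | ε < |T n ω - m|}).toReal) atTop (𝓝 0) :=
    fun ε hε => (ENNReal.tendsto_toReal ENNReal.zero_ne_top).comp (hprob ε hε)
  rcases lt_or_gt_of_ne hx with hxm | hxm
  · rw [Set.indicator_of_mem (Set.mem_Iio.2 hxm), ← ENNReal.ofReal_one]
    refine ENNReal.tendsto_ofReal (h1.comp (tendsto_nhdsWithin_iff.2 ⟨?_, Eventually.of_forall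
      fun n => measureReal_le_one⟩))
    have hε := hprob' ((m - x) / 2) (by linarith)
    refine tendsto_of_tendsto_of_tendsto_of_le_of_le (by simpa using hε.const_sub 1)
      tendsto_const_nhds (fun n => ?_) fun n => measureReal_le_one
    have hnull : NullMeasurableSet {ω | x < T n ω} P :=
      nullMeasurableSet_lt aemeasurable_const (hT n)
    have hcompl := probReal_compl_eq_one_sub₀ hnull
    have hsub : P.real {ω | x < T n ω}ᶜ ≤ P.real {ω | (m - x) / 2 < |T n ω - m|} :=
      measureReal_mono fun ω hω => by
        have hω' : T n ω ≤ x := not_lt.1 hω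
        show (m - x) / 2 < |T n ω - m|
        exact lt_abs.2 (Or.inr (by linarith))
    change 1 - P.real _ ≤ P.real _
    linarith
  · rw [Set.indicator_of_notMem (Set.notMem_Iio.2 (le_of_lt hxm)), ← ENNReal.ofReal_zero]
    refine ENNReal.tendsto_ofReal (h0.comp (tendsto_nhdsWithin_iff.2 ⟨?_, Eventually.of_forall
      fun n => ENNReal.toReal_nonneg⟩))
    refine tendsto_of_tendsto_of_tendsto_of_le_of_le tendsto_const_nhds
      (hprob' ((x - m) / 2) (by linarith)) (fun n => ENNReal.toReal_nonneg) fun n => ?_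
    refine measureReal_mono fun ω hω => ?_
    have hω' : x < T n ω := hω
    show (x - m) / 2 < |T n ω - m|
    exact lt_abs.2 (Or.inl (by linarith))

end Distortion

section WeightedMean

variable {Ω : Type*} [MeasurableSpace Ω] {P : Measure Ω}

/-- The `p`-th power of a weighted mean is integrable, with integral bounded by any common bound for
the `p`-th moments. -/
theorem integrable_rpow_weighted_mean {p : ℝ} (hp : 1 ≤ p) {s : Finset ℕ} {w : ℕ → ℝ}
    (hw : ∀ i ∈ s, 0 ≤ w i) (hw1 : ∑ i ∈ s, w i = 1) {X : ℕ → Ω → ℝ}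
    (hXmeas : ∀ n, AEMeasurable (X n) P) (hXpos : ∀ n, ∀ᵐ ω ∂P, 0 ≤ X n ω)
    (hXp : ∀ n, Integrable (fun ω => X n ω ^ p) P) {M : ℝ} (hM : ∀ n, ∫ ω, X n ω ^ p ∂P ≤ M) :
    Integrable (fun ω => (∑ i ∈ s, w i * X i ω) ^ p) P ∧
      ∫ ω, (∑ i ∈ s, w i * X i ω) ^ p ∂P ≤ M := by
  have hle : ∀ᵐ ω ∂P, (∑ i ∈ s, w i * X i ω) ^ p ≤ ∑ i ∈ s, w i * X i ω ^ p := by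
    filter_upwards [ae_all_iff.2 hXpos] with ω hω
    exact Real.rpow_arith_mean_le_arith_mean_rpow s w _ hw hw1 (fun i _ => hω i) hp
  have hnn : ∀ᵐ ω ∂P, 0 ≤ (∑ i ∈ s, w i * X i ω) ^ p := by
    filter_upwards [ae_all_iff.2 hXpos] with ω hω
    exact Real.rpow_nonneg (Finset.sum_nonneg fun i hi => mul_nonneg (hw i hi) (hω i)) p
  have hbound : Integrable (fun ω => ∑ i ∈ s, w i * X i ω ^ p) P :=
    integrable_finsetSum _ fun i _ => (hXp i).const_mul (w i)
  have hmeas : AEMeasurable (fun ω => ∑ i ∈ s, w i * X i ω) P :=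
    Finset.aemeasurable_fun_sum _ fun i _ => (hXmeas i).const_mul (w i)
  have hint : Integrable (fun ω => (∑ i ∈ s, w i * X i ω) ^ p) P := by
    refine hbound.mono' (hmeas.pow_const p).aestronglyMeasurable ?_
    filter_upwards [hle, hnn] with ω h1 h2
    rwa [Real.norm_of_nonneg h2]
  refine ⟨hint, (integral_mono_ae hint hbound hle).trans ?_⟩
  rw [integral_finsetSum _ fun i _ => (hXp i).const_mul (w i)]
  calc ∑ i ∈ s, ∫ ω, w i * X i ω ^ p ∂P ≤ ∑ i ∈ s, w i * M := by
        refine Finset.sum_le_sum fun i hi => ?_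
        rw [integral_const_mul]
        exact mul_le_mul_of_nonneg_left (hM i) (hw i hi)
    _ = M := by rw [← Finset.sum_mul, hw1, one_mul]

end WeightedMean

/-- Asymptotic ratio of distortion premia between a co-monotonic
alternative and a diversified benchmark. Here
`H(X) = C * (∫⁻ x in (0,∞), h(P(X > x)))`. -/
theorem stmt_7
    {Ω : Type*} [MeasurableSpace Ω] (P : Measure Ω) [IsProbabilityMeasure P]
    (p : ℝ) (hp : 1 ≤ p) (C : ℝ) (hC : 0 < C)
    (h : ℝ → ℝ)
    (hmono : MonotoneOn h (Set.Ici 0))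
    (hrange : ∀ t : ℝ, 0 ≤ t → h t ∈ Set.Icc (0:ℝ) 1)
    (hone : ∀ t : ℝ, 1 < t → h t = 1)
    (hzero : Tendsto h (𝓝[>] 0) (𝓝 0))
    (hone' : Tendsto h (𝓝[<] 1) (𝓝 1))
    (hint : ∫⁻ x in Set.Ioi (1:ℝ), ENNReal.ofReal (h (x ^ (-p))) < ⊤)
    (lam : ℕ → ℝ) (hlam : ∀ n, 0 < lam n)
    (X : ℕ → Ω → ℝ)
    (hXmeas : ∀ n, AEMeasurable (X n) P)
    (hXpos : ∀ n, ∀ᵐ ω ∂P, 0 ≤ X n ω)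
    (hXint : ∀ n, Integrable (X n) P)
    (hXp : ∀ n, Integrable (fun ω => X n ω ^ p) P)
    (hXpbdd : ∃ M : ℝ, ∀ n, ∫ ω, X n ω ^ p ∂P ≤ M)
    (hXmean : ∀ n, ∫ ω, X n ω ∂P = ∫ ω, X 0 ω ∂P)
    (hXmeanpos : 0 < ∫ ω, X 0 ω ∂P)
    (hwlln : ∀ ε > (0:ℝ), Tendsto
      (fun n => P {ω | ε < |(∑ i ∈ Finset.range n, lam i)⁻¹ *
          ∑ i ∈ Finset.range n, lam i * (X i ω - ∫ ω', X 0 ω' ∂P)|}) atTop (𝓝 0))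
    (Z : ℕ → Ω → ℝ)
    (hZmeas : ∀ n, AEMeasurable (Z n) P)
    (hZpos : ∀ n, ∀ᵐ ω ∂P, 0 ≤ Z n ω)
    (hZp : ∀ n, Integrable (fun ω => Z n ω ^ p) P)
    (hZcom : ∀ n : ℕ, CoMonotonic P (fun i : Fin n => Z i))
    (hZH : ∀ n,
      C * (∫⁻ x in Set.Ioi (0:ℝ),
          ENNReal.ofReal (h ((P {ω | x < Z n ω}).toReal))).toReal =
      C * (∫⁻ x in Set.Ioi (0:ℝ),
          ENNReal.ofReal (h ((P {ω | x < Z 0 ω}).toReal))).toReal) :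
    Tendsto (fun n =>
        (C * (∫⁻ x in Set.Ioi (0:ℝ), ENNReal.ofReal
          (h ((P {ω | x < ∑ i ∈ Finset.range n, lam i * Z i ω}).toReal))).toReal) /
        (C * (∫⁻ x in Set.Ioi (0:ℝ), ENNReal.ofReal
          (h ((P {ω | x < ∑ i ∈ Finset.range n, lam i * X i ω}).toReal))).toReal))
      atTop
      (𝓝 ((∫⁻ x in Set.Ioi (0:ℝ),
          ENNReal.ofReal (h ((P {ω | x < Z 0 ω}).toReal))).toReal /
        ∫ ω, X 0 ω ∂P)) := by
  have hp0 : 0 < p := by linarith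
  have hnonneg : ∀ t, 0 ≤ t → 0 ≤ h t := fun t ht => (hrange t ht).1
  have hle : ∀ t, 0 ≤ t → h t ≤ 1 := fun t ht => (hrange t ht).2
  have h0 : h 0 = 0 := by
    refine le_antisymm (ge_of_tendsto hzero ?_) (hnonneg 0 le_rfl)
    filter_upwards [self_mem_nhdsWithin] with t ht
    have ht' : 0 ≤ t := le_of_lt ht
    exact hmono Set.self_mem_Ici ht' ht'
  have h1 : h 1 = 1 := by
    refine le_antisymm (hle 1 zero_le_one) (le_of_tendsto hone' ?_)
    filter_upwards [Ioo_mem_nhdsLT (zero_lt_one' ℝ)] with t ht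
    exact hmono ht.1.le (zero_le_one' ℝ) ht.2.le
  have h0lim : Tendsto h (𝓝[≥] 0) (𝓝 0) := by
    rw [← Set.Ioi_insert, nhdsWithin_insert, tendsto_sup]
    exact ⟨by simpa [h0] using tendsto_pure_nhds h 0, hzero⟩
  have h1lim : Tendsto h (𝓝[≤] 1) (𝓝 1) := by
    rw [← Set.Iio_insert, nhdsWithin_insert, tendsto_sup]
    exact ⟨by simpa [h1] using tendsto_pure_nhds h 1, hone'⟩
  obtain ⟨M, hM⟩ := hXpbdd
  set m := ∫ ω, X 0 ω ∂P with hm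
  set L : ℕ → ℝ := fun n => ∑ i ∈ Finset.range n, lam i with hL
  have hLpos : ∀ n, 0 < L (n + 1) := fun n =>
    Finset.sum_pos (fun i _ => hlam i) (by simp)
  set T : ℕ → Ω → ℝ := fun n ω => ∑ i ∈ Finset.range (n + 1), ((L (n + 1))⁻¹ * lam i) * X i ω
    with hTdef
  have hTeq : ∀ n ω, T n ω = (L (n + 1))⁻¹ * ∑ i ∈ Finset.range (n + 1), lam i * X i ω :=
    fun n ω => by simp only [hTdef, Finset.mul_sum, mul_assoc]
  have hw : ∀ n, ∀ i ∈ Finset.range (n + 1), 0 ≤ (L (n + 1))⁻¹ * lam i := fun n i _ =>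
    mul_nonneg (inv_nonneg.2 (hLpos n).le) (hlam i).le
  have hw1 : ∀ n, ∑ i ∈ Finset.range (n + 1), (L (n + 1))⁻¹ * lam i = 1 := fun n => by
    rw [← Finset.mul_sum]
    exact inv_mul_cancel₀ (hLpos n).ne'
  have hM0 : 0 ≤ M :=
    (integral_nonneg_of_ae ((hXpos 0).mono fun ω hω => Real.rpow_nonneg hω p)).trans (hM 0)
  have hTmom := fun n => integrable_rpow_weighted_mean hp (hw n) (hw1 n) hXmeas hXpos hXp hM
  have hden : Tendsto (fun n => distortionPremium P h (T n)) atTop (𝓝 (ENNReal.ofReal m)) := by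
    refine tendsto_distortionPremium_of_tendsto_const hmono hle h0lim h1lim hp0 hint
      (c := (M + 1) ^ p⁻¹) (fun n => ?_) (fun n => ?_) (fun n => (hTmom n).1) (by positivity)
      (fun n => ?_) fun ε hε => ?_
    · exact Finset.aemeasurable_fun_sum _ fun i _ => (hXmeas i).const_mul _
    · filter_upwards [ae_all_iff.2 hXpos] with ω hω
      exact Finset.sum_nonneg fun i hi => mul_nonneg (hw n i hi) (hω i)
    · rw [Real.rpow_inv_rpow (by positivity) hp0.ne']
      linarith [(hTmom n).2]
    · refine ((hwlln ε hε).comp (tendsto_add_atTop_nat 1)).congr fun n => ?_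
      simp only [Function.comp_apply]
      congr 1
      ext ω
      have hc : (L (n + 1))⁻¹ * ∑ i ∈ Finset.range (n + 1), lam i * (X i ω - m) = T n ω - m := by
        simp only [mul_sub, Finset.sum_sub_distrib, ← Finset.sum_mul]
        rw [hTeq]
        congr 1
        exact inv_mul_cancel_left₀ (hLpos n).ne' m
      exact Eq.to_iff (by rw [Set.mem_ofPred_eq, Set.mem_ofPred_eq, ← hc])
  have hdenReal : Tendsto (fun n => (distortionPremium P h (T n)).toReal) atTop (𝓝 m) := by
    have := (ENNReal.tendsto_toReal ENNReal.ofReal_ne_top).comp hden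
    rwa [ENNReal.toReal_ofReal hXmeanpos.le] at this
  have hnum : ∀ n, (distortionPremium P h
      (fun ω => ∑ i ∈ Finset.range n, lam i * Z i ω)).toReal =
      L n * (distortionPremium P h (Z 0)).toReal := fun n => by
    rw [distortionPremium_sum_of_coMonotonic hmono hnonneg h0 hlam hZpos hZcom,
      ENNReal.toReal_sum fun i _ => ENNReal.mul_ne_top ENNReal.ofReal_ne_top
        (distortionPremium_lt_top hmono hle hp0 hint (hZpos i) (hZp i)).ne, hL, Finset.sum_mul]
    refine Finset.sum_congr rfl fun i _ => ?_
    rw [ENNReal.toReal_mul, ENNReal.toReal_ofReal (hlam i).le]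
    congr 1
    exact mul_left_cancel₀ hC.ne' (hZH i)
  refine (tendsto_add_atTop_iff_nat 1).1 ((Tendsto.div
    (tendsto_const_nhds (x := (distortionPremium P h (Z 0)).toReal)) hdenReal hXmeanpos.ne').congr fun n => ?_)
  have hS : (fun ω => ∑ i ∈ Finset.range (n + 1), lam i * X i ω) =
      fun ω => L (n + 1) * T n ω := by
    ext ω
    rw [hTeq, mul_inv_cancel_left₀ (hLpos n).ne']
  have hdenom : (distortionPremium P h
      (fun ω => ∑ i ∈ Finset.range (n + 1), lam i * X i ω)).toReal =
      L (n + 1) * (distortionPremium P h (T n)).toReal := by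
    rw [hS, distortionPremium_const_mul (hLpos n), ENNReal.toReal_mul,
      ENNReal.toReal_ofReal (hLpos n).le]
  change _ = C * (distortionPremium P h _).toReal / (C * (distortionPremium P h _).toReal)
  rw [hnum, hdenom, mul_div_mul_left _ _ hC.ne', mul_div_mul_left _ _ (hLpos n).ne']
  rfl
end

section
/- Let (Ω,F,P) be a probability space, B a Banach space, C ⊆ B a closed convex cone (C is closed, 0 ∈ C, C + C ⊆ C, and λx ∈ C for all λ > 0 and x ∈ C), L a topological space, and f : L^0(Ω;C) → L. Assume that for every sequence (X_n) ⊂ L^0(Ω;C): if there exist X* ∈ L^0(Ω;C) and a sequence (λ_n) ⊂ (0,∞) with λ_n → 0 such that λ_n X* − X_n ∈ C P-a.s. for all n, then f(X_n) → f(0) in L. Then f is continuous at the origin with respect to convergence in probability: f(Y_n) → f(0) for every sequence (Y_n) ⊂ L^0(Ω;C) with Y_n → 0 in probability. -/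
open MeasureTheory Filter Topology

theorem tsum_mem_of_isClosed_of_add_mem {B : Type*} [NormedAddCommGroup B] {C : Set B}
    (hCclosed : IsClosed C) (hC0 : (0:B) ∈ C) (hCadd : ∀ x ∈ C, ∀ y ∈ C, x + y ∈ C)
    {ι : Type*} {g : ι → B} (hg : ∀ i, g i ∈ C) : ∑' i, g i ∈ C := by
  by_cases hs : Summable g
  · exact hCclosed.mem_of_tendsto hs.hasSum (Eventually.of_forall fun s =>
      Finset.sum_induction g (· ∈ C) (fun x y hx hy => hCadd x hx y hy) hC0 fun i _ => hg i)
  · rwa [tsum_eq_zero_of_not_summable hs]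

/-- In a closed convex cone, each term of a summable series is dominated by its sum. -/
theorem tsum_sub_mem_of_isClosed_of_add_mem {B : Type*} [NormedAddCommGroup B] {C : Set B}
    (hCclosed : IsClosed C) (hC0 : (0:B) ∈ C) (hCadd : ∀ x ∈ C, ∀ y ∈ C, x + y ∈ C)
    {g : ℕ → B} (hs : Summable g) (hg : ∀ i, g i ∈ C) (k : ℕ) : ∑' i, g i - g k ∈ C := by
  rw [hs.tsum_eq_add_tsum_ite k, add_sub_cancel_left]
  refine tsum_mem_of_isClosed_of_add_mem hCclosed hC0 hCadd fun i => ?_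
  split_ifs
  exacts [hC0, hg i]

theorem summable_two_pow_smul {B : Type*} [NormedAddCommGroup B] [NormedSpace ℝ B]
    [CompleteSpace B] {z : ℕ → B} (hz : ∀ᶠ k in atTop, ‖z k‖ ≤ (1 / 4 : ℝ) ^ k) :
    Summable fun k => (2 : ℝ) ^ k • z k := by
  refine .of_norm_bounded_eventually_nat (g := fun k => (1 / 2 : ℝ) ^ k)
    summable_geometric_two ?_
  filter_upwards [hz] with k hk
  calc ‖(2 : ℝ) ^ k • z k‖ = 2 ^ k * ‖z k‖ := by simp [norm_smul]
    _ ≤ 2 ^ k * (1 / 4) ^ k := by gcongr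
    _ = (1 / 2) ^ k := by rw [← mul_pow]; norm_num

/-- If `f : L^0(Ω;C) → L` maps every sequence dominated (in the cone
order induced by `C`) by vanishing multiples of a fixed element to `f 0`, then `f` is
continuous at the origin with respect to convergence in probability. -/
theorem stmt_9
    {Ω : Type*} [MeasurableSpace Ω] (P : Measure Ω) [IsProbabilityMeasure P]
    {B : Type*} [NormedAddCommGroup B] [NormedSpace ℝ B] [CompleteSpace B]
    (C : Set B) (hCclosed : IsClosed C) (hC0 : (0:B) ∈ C)
    (hCadd : ∀ x ∈ C, ∀ y ∈ C, x + y ∈ C)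
    (hCsmul : ∀ c : ℝ, 0 < c → ∀ x ∈ C, c • x ∈ C)
    {L : Type*} [TopologicalSpace L]
    (f : (Ω → B) → L)
    (hyp : ∀ X : ℕ → Ω → B,
      (∀ n, AEStronglyMeasurable (X n) P ∧ ∀ᵐ ω ∂P, X n ω ∈ C) →
      (∃ (Xs : Ω → B) (lam : ℕ → ℝ),
        (AEStronglyMeasurable Xs P ∧ ∀ᵐ ω ∂P, Xs ω ∈ C) ∧
        (∀ n, 0 < lam n) ∧ Tendsto lam atTop (𝓝 0) ∧
        (∀ n, ∀ᵐ ω ∂P, lam n • Xs ω - X n ω ∈ C)) →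
      Tendsto (fun n => f (X n)) atTop (𝓝 (f 0))) :
    ∀ Y : ℕ → Ω → B,
      (∀ n, AEStronglyMeasurable (Y n) P ∧ ∀ᵐ ω ∂P, Y n ω ∈ C) →
      (∀ ε > (0:ℝ), Tendsto (fun n => P {ω | ε < ‖Y n ω‖}) atTop (𝓝 0)) →
      Tendsto (fun n => f (Y n)) atTop (𝓝 (f 0)) := by
  intro Y hY hP
  refine tendsto_of_subseq_tendsto fun ns hns => ?_
  have hex (k : ℕ) : ∃ m, P {ω | (1 / 4 : ℝ) ^ k < ‖Y (ns m) ω‖} ≤ (2⁻¹ : ENNReal) ^ k := by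
    have h := ((hP ((1 / 4 : ℝ) ^ k) (by positivity)).comp hns).eventually_le_const
      (u := (2⁻¹ : ENNReal) ^ k) (ENNReal.pow_pos (by simp) k)
    exact h.exists
  choose ms hms using hex
  refine ⟨ms, hyp (fun k => Y (ns (ms k))) (fun k => hY _) ?_⟩
  have hsmall : ∀ᵐ ω ∂P, ∀ᶠ k in atTop, ‖Y (ns (ms k)) ω‖ ≤ (1 / 4 : ℝ) ^ k := by
    have hsum : ∑' k, P {ω | (1 / 4 : ℝ) ^ k < ‖Y (ns (ms k)) ω‖} ≠ ⊤ := by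
      refine ne_top_of_le_ne_top ?_ (ENNReal.tsum_le_tsum hms)
      rw [ENNReal.tsum_geometric]
      simp
    filter_upwards [ae_eventually_notMem hsum] with ω hω
    filter_upwards [hω] with k hk
    exact not_lt.1 hk
  have hmem : ∀ᵐ ω ∂P, ∀ k, (2 : ℝ) ^ k • Y (ns (ms k)) ω ∈ C := by
    filter_upwards [ae_all_iff.2 fun k => (hY (ns (ms k))).2] with ω hω k
    exact hCsmul _ (by positivity) _ (hω k)
  refine ⟨fun ω => ∑' k, (2 : ℝ) ^ k • Y (ns (ms k)) ω, fun k => (1 / 2 : ℝ) ^ k,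
    ⟨?_, ?_⟩, fun k => by positivity,
    tendsto_pow_atTop_nhds_zero_of_lt_one (by norm_num) (by norm_num), fun k => ?_⟩
  · refine aestronglyMeasurable_of_tendsto_ae atTop
      (f := fun n ω => ∑ k ∈ Finset.range n, (2 : ℝ) ^ k • Y (ns (ms k)) ω)
      (fun n => Finset.aestronglyMeasurable_fun_sum _ fun k _ => (hY _).1.const_smul _) ?_
    filter_upwards [hsmall] with ω hω
    exact (summable_two_pow_smul hω).hasSum.tendsto_sum_nat
  · filter_upwards [hmem] with ω hω
    exact tsum_mem_of_isClosed_of_add_mem hCclosed hC0 hCadd hω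
  · filter_upwards [hsmall, hmem] with ω hω hωC
    have h := hCsmul ((1 / 2 : ℝ) ^ k) (by positivity) _
      (tsum_sub_mem_of_isClosed_of_add_mem hCclosed hC0 hCadd (summable_two_pow_smul hω) hωC k)
    rw [smul_sub, smul_smul, ← mul_pow] at h
    simpa using h
end
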